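/- For every positive integer d, let G = (D∞)^d be the d-fold direct power of the infinite dihedral group D∞ = ⟨a,b | a² = b² = 1⟩ and let μ be the d-fold product of the lazy simple random walk measure (μ₀(1) = μ₀(a) = μ₀(b) = 1/3 on each factor). Then (G,μ) is ℓ¹-noise sensitive, and G contains a subgroup of finite index isomorphic to ℤ^d. -/

import Mathlib

open Filter

namespace NS

/-- A probability measure on a countable (discrete) set, as a nonnegative
function summing to 1. -/
def IsProbMeasure {E : Type*} (ξ : E → ℝ) : Prop :=
  (∀ x, 0 ≤ ξ x) ∧ ∑' x, ξ x = 1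

/-- Convolution of two measures on a group. -/
noncomputable def conv {G : Type*} [Group G] (μ ν : G → ℝ) : G → ℝ :=
  fun g => ∑' h, μ h * ν (h⁻¹ * g)

/-- `convPow μ n` is the `n`-fold convolution `μ^{*n}`, the law of the random
walk at time `n` (with `μ^{*0}` the Dirac mass at the identity). -/
noncomputable def convPow {G : Type*} [Group G] (μ : G → ℝ) : ℕ → G → ℝ
  | 0 => ({1} : Set G).indicator (fun _ => (1 : ℝ))
  | n + 1 => conv μ (convPow μ n)

/-- The diagonal measure `μ^diag` on `G × G`. -/
noncomputable def diagM {G : Type*} [Group G] (μ : G → ℝ) : G × G → ℝ :=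
  {p : G × G | p.1 = p.2}.indicator (fun p => μ p.1)

/-- Product of two measures. -/
def prodM {G H : Type*} (μ : G → ℝ) (ν : H → ℝ) : G × H → ℝ :=
  fun p => μ p.1 * ν p.2

/-- The noise kernel `π^ρ = (1-ρ)·μ^diag + ρ·(μ×μ)` on `G × G`. -/
noncomputable def noise {G : Type*} [Group G] (μ : G → ℝ) (ρ : ℝ) : G × G → ℝ :=
  fun p => (1 - ρ) * diagM μ p + ρ * prodM μ μ p

/-- The `ℓ¹` distance between two measures. -/
noncomputable def l1dist {E : Type*} (ξ₁ ξ₂ : E → ℝ) : ℝ :=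
  ∑' x, |ξ₁ x - ξ₂ x|

/-- `(G,μ)` is `ℓ¹`-noise sensitive. -/
def L1NoiseSensitive {G : Type*} [Group G] (μ : G → ℝ) : Prop :=
  ∀ ρ ∈ Set.Ioo (0 : ℝ) 1,
    Tendsto
      (fun n => l1dist (convPow (noise μ ρ) n) (prodM (convPow μ n) (convPow μ n)))
      atTop (nhds 0)

/-- Shannon entropy of a measure. -/
noncomputable def entropy {E : Type*} (ξ : E → ℝ) : ℝ :=
  -∑' x, ξ x * Real.log (ξ x)

/-- `(G,μ)` is entropy noise sensitive: `H(Y_n^ρ | X_n) / H(X_n) → 1`, where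
`H(Y_n^ρ | X_n) = H(π_n^ρ) - H(μ_n)`. -/
def EntropyNoiseSensitive {G : Type*} [Group G] (μ : G → ℝ) : Prop :=
  ∀ ρ ∈ Set.Ioo (0 : ℝ) 1,
    Tendsto
      (fun n => (entropy (convPow (noise μ ρ) n) - entropy (convPow μ n))
        / entropy (convPow μ n))
      atTop (nhds 1)

/-- A function is `μ`-harmonic. -/
def Harmonic {G : Type*} [Group G] (μ : G → ℝ) (f : G → ℝ) : Prop :=
  ∀ y, f y = ∑' x, μ x * f (y * x)

/-- `(G,μ)` is Liouville: every bounded `μ`-harmonic function is constant. -/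
def Liouville {G : Type*} [Group G] (μ : G → ℝ) : Prop :=
  ∀ f : G → ℝ, Harmonic μ f → (∃ C, ∀ g, |f g| ≤ C) → ∀ x y, f x = f y

/-- Word distance for a generating set `S`: least length of a word in `S`
evaluating to `x⁻¹ * y`. -/
noncomputable def wordDist {G : Type*} [Group G] (S : Set G) (x y : G) : ℕ :=
  sInf {n : ℕ | ∃ w : List G, w.length = n ∧ (∀ g ∈ w, g ∈ S) ∧ w.prod = x⁻¹ * y}

/-- Expected distance `E d(X_n, X'_n)` between two independent samples of law `ξ`. -/
noncomputable def spread {G : Type*} [Group G] (S : Set G) (ξ : G → ℝ) : ℝ :=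
  ∑' p : G × G, ξ p.1 * ξ p.2 * (wordDist S p.1 p.2 : ℝ)

/-- Expected distance between the two coordinates under a measure on `G × G`. -/
noncomputable def avgDist {G : Type*} [Group G] (S : Set G) (π : G × G → ℝ) : ℝ :=
  ∑' p : G × G, π p * (wordDist S p.1 p.2 : ℝ)

/-- `ν` is a coupling of `ξ₁` and `ξ₂`. -/
def IsCoupling {E₁ E₂ : Type*} (ν : E₁ × E₂ → ℝ) (ξ₁ : E₁ → ℝ) (ξ₂ : E₂ → ℝ) : Prop :=
  (∀ p, 0 ≤ ν p) ∧ (∀ x, ∑' y, ν (x, y) = ξ₁ x) ∧ (∀ y, ∑' x, ν (x, y) = ξ₂ y)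

/-- `U^s(ξ₁,ξ₂)`: infimum over couplings `ν` of `ν(d(x,y) ≥ s)`. -/
noncomputable def Ufn {E₁ E₂ : Type*} (d : E₁ → E₂ → ℝ) (s : ℝ)
    (ξ₁ : E₁ → ℝ) (ξ₂ : E₂ → ℝ) : ℝ :=
  sInf {r : ℝ | ∃ ν : E₁ × E₂ → ℝ, IsCoupling ν ξ₁ ξ₂ ∧
    r = ∑' p : E₁ × E₂, {q : E₁ × E₂ | s ≤ d q.1 q.2}.indicator ν p}

/-- The `ℓ¹` product metric on `G × G` associated to the word metric of `S`. -/
noncomputable def wordDistProd {G : Type*} [Group G] (S : Set G) :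
    G × G → G × G → ℝ :=
  fun p q => (wordDist S p.1 q.1 : ℝ) + (wordDist S p.2 q.2 : ℝ)

/-- The relators `a²`, `b²` of the infinite dihedral group. -/
def dihedralRels : Set (FreeGroup (Fin 2)) :=
  {FreeGroup.of 0 ^ 2, FreeGroup.of 1 ^ 2}

/-- The infinite dihedral group `D∞ = ⟨a, b | a² = b² = 1⟩`. -/
abbrev DInf := PresentedGroup dihedralRels

/-- The generator `a` of `D∞`. -/
def Da : DInf := PresentedGroup.of 0

/-- The generator `b` of `D∞`. -/
def Db : DInf := PresentedGroup.of 1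

/-- The simple random walk measure `μ(a) = μ(b) = 1/2` on `D∞`. -/
noncomputable def muSimple : DInf → ℝ :=
  fun g => ({Da} : Set DInf).indicator (fun _ => (1:ℝ)/2) g +
    ({Db} : Set DInf).indicator (fun _ => (1:ℝ)/2) g

/-- The lazy simple random walk measure `μ(1) = μ(a) = μ(b) = 1/3` on `D∞`. -/
noncomputable def muLazy : DInf → ℝ :=
  fun g => ({1} : Set DInf).indicator (fun _ => (1:ℝ)/3) g +
    ({Da} : Set DInf).indicator (fun _ => (1:ℝ)/3) g +
    ({Db} : Set DInf).indicator (fun _ => (1:ℝ)/3) g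

/-- The `d`-fold product of the lazy simple random walk measure on `D∞`. -/
noncomputable def muLazyPow (d : ℕ) : (Fin d → DInf) → ℝ :=
  fun g => ∏ i, muLazy (g i)

set_option linter.unusedSectionVars false


/-! ### Abstract smoothing estimates in a normed algebra -/

section Smoothing

variable {R : Type*} [NormedRing R] [NormedAlgebra ℝ R]

/-- first order smallness with respect to powers of `z` -/
def Sm1 (z : R) (C : ℝ) (x : R) : Prop := ∀ j : ℕ, ‖z ^ j * x‖ * ((j : ℝ) + 1) ≤ C

/-- second order smallness with respect to powers of `z` -/
def Sm2 (z : R) (C : ℝ) (x : R) : Prop :=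
  ∀ j : ℕ, ‖z ^ j * x‖ * (((j : ℝ) + 1) * ((j : ℝ) + 2)) ≤ C

lemma Sm1.nonneg {z x : R} {C : ℝ} (h : Sm1 z C x) : 0 ≤ C :=
  le_trans (by positivity) (h 0)

lemma Sm1.mono {z x : R} {C C' : ℝ} (h : Sm1 z C x) (hC : C ≤ C') : Sm1 z C' x :=
  fun j => (h j).trans hC

lemma Sm1.add {z x y : R} {C C' : ℝ} (h : Sm1 z C x) (h' : Sm1 z C' y) :
    Sm1 z (C + C') (x + y) := by
  intro j
  have h1 := h j
  have h2 := h' j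
  have h3 : ‖z ^ j * (x + y)‖ ≤ ‖z ^ j * x‖ + ‖z ^ j * y‖ := by
    rw [mul_add]; exact norm_add_le _ _
  have : (0 : ℝ) ≤ (j : ℝ) + 1 := by positivity
  nlinarith

lemma Sm1.mul_right {z x : R} {C : ℝ} (h : Sm1 z C x) (a : R) :
    Sm1 z (C * ‖a‖) (x * a) := by
  intro j
  have h1 := h j
  have h3 : ‖z ^ j * (x * a)‖ ≤ ‖z ^ j * x‖ * ‖a‖ := by
    rw [← mul_assoc]; exact norm_mul_le _ _
  have h4 : (0 : ℝ) ≤ (j : ℝ) + 1 := by positivity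
  calc ‖z ^ j * (x * a)‖ * ((j : ℝ) + 1) ≤ ‖z ^ j * x‖ * ‖a‖ * ((j : ℝ) + 1) := by gcongr
    _ = ‖z ^ j * x‖ * ((j : ℝ) + 1) * ‖a‖ := by ring
    _ ≤ C * ‖a‖ := by gcongr

lemma Sm1.mul_left {z x : R} {C : ℝ} (hz : ∀ y, Commute z y) (h : Sm1 z C x) (a : R) :
    Sm1 z (‖a‖ * C) (a * x) := by
  intro j
  have h1 := h j
  have h3 : ‖z ^ j * (a * x)‖ ≤ ‖a‖ * ‖z ^ j * x‖ := by
    rw [← mul_assoc, ((hz a).pow_left j).eq, mul_assoc]; exact norm_mul_le _ _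
  have h4 : (0 : ℝ) ≤ (j : ℝ) + 1 := by positivity
  calc ‖z ^ j * (a * x)‖ * ((j : ℝ) + 1) ≤ ‖a‖ * ‖z ^ j * x‖ * ((j : ℝ) + 1) := by gcongr
    _ = ‖a‖ * (‖z ^ j * x‖ * ((j : ℝ) + 1)) := by ring
    _ ≤ ‖a‖ * C := by gcongr

lemma Sm1.smul {z x : R} {C : ℝ} (h : Sm1 z C x) (a : ℝ) :
    Sm1 z (|a| * C) (a • x) := by
  intro j
  have h1 := h j
  rw [mul_smul_comm, norm_smul, Real.norm_eq_abs, mul_assoc]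
  gcongr

lemma Sm1.mul {z x y : R} {C C' : ℝ} (hz : ∀ y, Commute z y) (hz1 : ‖z‖ ≤ 1)
    (h : Sm1 z C x) (h' : Sm1 z C' y) : Sm2 z (8 * (C * C')) (x * y) := by
  intro k
  obtain ⟨j, r, hk, hr⟩ : ∃ j r : ℕ, k = r + (j + j) ∧ r ≤ 1 := ⟨k / 2, k % 2, by omega, by omega⟩
  have h1 := h j
  have h2 := h' j
  have h3 : ‖z ^ k * (x * y)‖ ≤ ‖z ^ j * x‖ * ‖z ^ j * y‖ := by
    have e : z ^ k * (x * y) = z ^ r * ((z ^ j * x) * (z ^ j * y)) := by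
      rw [hk, pow_add, pow_add, mul_assoc, mul_assoc, mul_assoc, ← mul_assoc (z ^ j) x y,
        ((hz (z ^ j * x)).pow_left j).left_comm]
      rw [((hz x).pow_left j).eq]; simp only [mul_assoc]
      rw [((hz x).pow_left j).left_comm]
    rw [e]
    have : ‖z ^ r * ((z ^ j * x) * (z ^ j * y))‖ ≤ ‖(z ^ j * x) * (z ^ j * y)‖ := by
      interval_cases r
      · simp
      · refine (norm_mul_le _ _).trans ?_
        rw [pow_one]
        exact mul_le_of_le_one_left (norm_nonneg _) hz1
    exact this.trans (norm_mul_le _ _)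
  have h4 : ((k : ℝ) + 1) * ((k : ℝ) + 2) ≤ 8 * (((j : ℝ) + 1) * ((j : ℝ) + 1)) := by
    have : (k : ℝ) ≤ 2 * j + 1 := by
      have : k ≤ 2 * j + 1 := by omega
      exact_mod_cast this
    have hk0 : (0 : ℝ) ≤ k := by positivity
    have hj0 : (0 : ℝ) ≤ j := by positivity
    nlinarith
  calc ‖z ^ k * (x * y)‖ * (((k : ℝ) + 1) * ((k : ℝ) + 2))
      ≤ (‖z ^ j * x‖ * ‖z ^ j * y‖) * (8 * (((j : ℝ) + 1) * ((j : ℝ) + 1))) := by gcongr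
    _ = 8 * ((‖z ^ j * x‖ * ((j : ℝ) + 1)) * (‖z ^ j * y‖ * ((j : ℝ) + 1))) := by ring
    _ ≤ 8 * (C * C') := by
        have := h.nonneg
        gcongr

/-- binomial averages -/
lemma binom_avg1 (ε : ℝ) (h0 : 0 < ε) (h1 : ε ≤ 1) (N : ℕ) (f : ℕ → ℝ) (C : ℝ) 
    (hf : ∀ j : ℕ, f j * ((j : ℝ) + 1) ≤ C) (hC : 0 ≤ C) :
    (∑ j ∈ Finset.range (N + 1), ε ^ j * (1 - ε) ^ (N - j) * (N.choose j) * f j) *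
      (ε * ((N : ℝ) + 1)) ≤ C := by
  have hs : ∑ j ∈ Finset.range (N + 1), ε ^ (j + 1) * (1 - ε) ^ (N - j) * ((N + 1).choose (j + 1)) ≤ 1 := by
    have := add_pow ε (1 - ε) (N + 1)
    rw [add_sub_cancel, one_pow, Finset.sum_range_succ'] at this
    simp only [Nat.add_sub_add_right] at this
    have h2 : 0 ≤ ε ^ 0 * (1 - ε) ^ (N + 1 - 0) * (((N + 1).choose 0 : ℕ) : ℝ) := by
      have : 0 ≤ 1 - ε := by linarith
      positivity
    linarith
  have h3 : 0 ≤ 1 - ε := by linarith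
  calc _ = ∑ j ∈ Finset.range (N + 1), (ε ^ (j + 1) * (1 - ε) ^ (N - j) * ((N + 1).choose (j + 1))) * (f j * ((j : ℝ) + 1)) := by
        rw [Finset.sum_mul]
        refine Finset.sum_congr rfl fun j _ => ?_
        have := Nat.add_one_mul_choose_eq N j
        have h : ((N : ℝ) + 1) * (N.choose j) = ((N + 1).choose (j + 1)) * ((j : ℝ) + 1) := by
          exact_mod_cast this
        calc _ = ε ^ (j + 1) * (1 - ε) ^ (N - j) * f j * (((N : ℝ) + 1) * (N.choose j)) := by ring
          _ = _ := by rw [h]; ring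
    _ ≤ ∑ j ∈ Finset.range (N + 1), (ε ^ (j + 1) * (1 - ε) ^ (N - j) * ((N + 1).choose (j + 1))) * C := by
        gcongr with j _
        exact hf j
    _ ≤ C := by
        rw [← Finset.sum_mul]
        exact mul_le_of_le_one_left hC hs

lemma binom_avg2 (ε : ℝ) (h0 : 0 < ε) (h1 : ε ≤ 1) (N : ℕ) (f : ℕ → ℝ) (C : ℝ) 
    (hf : ∀ j : ℕ, f j * (((j : ℝ) + 1) * ((j : ℝ) + 2)) ≤ C) (hC : 0 ≤ C) :
    (∑ j ∈ Finset.range (N + 1), ε ^ j * (1 - ε) ^ (N - j) * (N.choose j) * f j) *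
      (ε ^ 2 * (((N : ℝ) + 1) * ((N : ℝ) + 2))) ≤ C := by
  have h3 : 0 ≤ 1 - ε := by linarith
  have hs : ∑ j ∈ Finset.range (N + 1), ε ^ (j + 2) * (1 - ε) ^ (N - j) * ((N + 2).choose (j + 2)) ≤ 1 := by
    have := add_pow ε (1 - ε) (N + 2)
    rw [add_sub_cancel, one_pow, Finset.sum_range_succ', Finset.sum_range_succ'] at this
    simp only [add_assoc, Nat.reduceAdd] at this
    have h2 : 0 ≤ ε ^ 0 * (1 - ε) ^ (N + 2 - 0) * (((N + 2).choose 0 : ℕ) : ℝ) := by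
      positivity
    have h4 : 0 ≤ ε ^ (0 + 1) * (1 - ε) ^ (N + 2 - (0 + 1)) * (((N + 2).choose (0 + 1) : ℕ) : ℝ) := by
      positivity
    simp only [zero_add] at this h2 h4
    simp only [Nat.add_sub_add_right] at this
    linarith
  calc _ = ∑ j ∈ Finset.range (N + 1), (ε ^ (j + 2) * (1 - ε) ^ (N - j) * ((N + 2).choose (j + 2))) * (f j * (((j : ℝ) + 1) * ((j : ℝ) + 2))) := by
        rw [Finset.sum_mul]
        refine Finset.sum_congr rfl fun j _ => ?_
        have h := Nat.add_one_mul_choose_eq N j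
        have h' := Nat.add_one_mul_choose_eq (N + 1) (j + 1)
        have h : ((N : ℝ) + 1) * (N.choose j) = ((N + 1).choose (j + 1)) * ((j : ℝ) + 1) := by
          exact_mod_cast h
        have h' : ((N : ℝ) + 2) * ((N + 1).choose (j + 1)) = ((N + 2).choose (j + 2)) * ((j : ℝ) + 2) := by
          exact_mod_cast h'
        calc _ = ε ^ (j + 2) * (1 - ε) ^ (N - j) * f j * (((N : ℝ) + 2) * (((N : ℝ) + 1) * (N.choose j))) := by ring
          _ = ε ^ (j + 2) * (1 - ε) ^ (N - j) * f j * ((((N : ℝ) + 2) * ((N + 1).choose (j + 1))) * ((j : ℝ) + 1)) := by rw [h]; ring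
          _ = _ := by rw [h']; ring
    _ ≤ ∑ j ∈ Finset.range (N + 1), (ε ^ (j + 2) * (1 - ε) ^ (N - j) * ((N + 2).choose (j + 2))) * C := by
        gcongr with j _
        exact hf j
    _ ≤ C := by
        rw [← Finset.sum_mul]
        exact mul_le_of_le_one_left hC hs

/-- `P` is a contraction whose square dominates a multiple of the central element `z`. -/
def IsSmoother (z : R) (ε : ℝ) (P : R) : Prop :=
  ‖P‖ ≤ 1 ∧ 0 < ε ∧ ε ≤ 1 ∧ ∃ P' : R, ‖P'‖ ≤ 1 ∧ P * P = ε • z + (1 - ε) • P'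

lemma pow_norm_le_one [NormOneClass R] {P : R} (h : ‖P‖ ≤ 1) (n : ℕ) : ‖P ^ n‖ ≤ 1 :=
  (norm_pow_le P n).trans (pow_le_one₀ (norm_nonneg _) h)

lemma IsSmoother.binom [NormOneClass R] {z P : R} {ε : ℝ} (hz : ∀ y, Commute z y)
    (h : IsSmoother z ε P) (x : R) (N : ℕ) :
    ‖P ^ (2 * N) * x‖ ≤ ∑ j ∈ Finset.range (N + 1), ε ^ j * (1 - ε) ^ (N - j) * (N.choose j) * ‖z ^ j * x‖
    ∧ ‖x * P ^ (2 * N)‖ ≤ ∑ j ∈ Finset.range (N + 1), ε ^ j * (1 - ε) ^ (N - j) * (N.choose j) * ‖z ^ j * x‖ := by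
  obtain ⟨hP, h0, h1, P', hP', e⟩ := h
  have h3 : 0 ≤ 1 - ε := by linarith
  have e2 : P ^ (2 * N) = ∑ j ∈ Finset.range (N + 1), (ε ^ j * (1 - ε) ^ (N - j) * (N.choose j) : ℝ) • (z ^ j * P' ^ (N - j)) := by
    rw [pow_mul, sq, e, Commute.add_pow]
    · refine Finset.sum_congr rfl fun j _ => ?_
      rw [smul_pow, smul_pow, smul_mul_assoc, mul_smul_comm, smul_smul, smul_mul_assoc,
        ← Nat.cast_comm, ← nsmul_eq_mul, ← Nat.cast_smul_eq_nsmul ℝ, smul_smul]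
    · exact ((hz P').smul_left ε).smul_right (1 - ε)
  constructor
  · rw [e2, Finset.sum_mul]
    refine (norm_sum_le _ _).trans (Finset.sum_le_sum fun j _ => ?_)
    rw [smul_mul_assoc, norm_smul, Real.norm_of_nonneg (by positivity)]
    gcongr
    rw [((hz _).pow_left j).eq, mul_assoc]
    exact (norm_mul_le _ _).trans (mul_le_of_le_one_left (norm_nonneg _) (pow_norm_le_one hP' _))
  · rw [e2, Finset.mul_sum]
    refine (norm_sum_le _ _).trans (Finset.sum_le_sum fun j _ => ?_)
    rw [mul_smul_comm, norm_smul, Real.norm_of_nonneg (by positivity)]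
    gcongr
    rw [← mul_assoc, ← ((hz _).pow_left j).eq]
    exact (norm_mul_le _ _).trans (mul_le_of_le_one_right (norm_nonneg _) (pow_norm_le_one hP' _))

lemma IsSmoother.sm1 [NormOneClass R] {z P : R} {ε : ℝ} (hz : ∀ y, Commute z y)
    (h : IsSmoother z ε P) {x : R} {C : ℝ} (hx : Sm1 z C x) (n : ℕ) :
    ‖P ^ n * x‖ * ((n : ℝ) + 1) ≤ 2 / ε * C ∧ ‖x * P ^ n‖ * ((n : ℝ) + 1) ≤ 2 / ε * C := by
  have h0 := h.2.1
  obtain ⟨N, r, hk, hr⟩ : ∃ N r : ℕ, n = r + 2 * N ∧ r ≤ 1 := ⟨n / 2, n % 2, by omega, by omega⟩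
  have hN : (n : ℝ) + 1 ≤ 2 * ((N : ℝ) + 1) := by
    have : n + 1 ≤ 2 * (N + 1) := by omega
    exact_mod_cast this
  have key := binom_avg1 ε h.2.1 h.2.2.1 N (fun j => ‖z ^ j * x‖) C hx hx.nonneg
  obtain ⟨b1, b2⟩ := h.binom hz x N
  have fin : ∀ t : ℝ, 0 ≤ t → t ≤ ∑ j ∈ Finset.range (N + 1), ε ^ j * (1 - ε) ^ (N - j) * (N.choose j) * ‖z ^ j * x‖ →
      t * ((n : ℝ) + 1) ≤ 2 / ε * C := by
    intro t ht0 ht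
    rw [div_mul_eq_mul_div, le_div_iff₀ h0]
    calc t * ((n : ℝ) + 1) * ε ≤ t * (2 * ((N : ℝ) + 1)) * ε := by gcongr
      _ = 2 * (t * (ε * ((N : ℝ) + 1))) := by ring
      _ ≤ 2 * C := by
        refine mul_le_mul_of_nonneg_left (le_trans ?_ key) (by norm_num)
        gcongr
  constructor
  · refine fin _ (norm_nonneg _) (le_trans ?_ b1)
    rw [hk, pow_add, mul_assoc]
    exact (norm_mul_le _ _).trans (mul_le_of_le_one_left (norm_nonneg _) (pow_norm_le_one h.1 _))
  · refine fin _ (norm_nonneg _) (le_trans ?_ b2)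
    rw [hk, add_comm, pow_add, ← mul_assoc]
    exact (norm_mul_le _ _).trans (mul_le_of_le_one_right (norm_nonneg _) (pow_norm_le_one h.1 _))

lemma Sm2.nonneg {z x : R} {C : ℝ} (h : Sm2 z C x) : 0 ≤ C :=
  le_trans (by positivity) (h 0)

lemma IsSmoother.sm2 [NormOneClass R] {z P : R} {ε : ℝ} (hz : ∀ y, Commute z y)
    (h : IsSmoother z ε P) {x : R} {C : ℝ} (hx : Sm2 z C x) (n : ℕ) :
    ‖P ^ n * x‖ * ((n : ℝ) + 1) ^ 2 ≤ 4 / ε ^ 2 * C ∧ ‖x * P ^ n‖ * ((n : ℝ) + 1) ^ 2 ≤ 4 / ε ^ 2 * C := by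
  have h0 := h.2.1
  obtain ⟨N, r, hk, hr⟩ : ∃ N r : ℕ, n = r + 2 * N ∧ r ≤ 1 := ⟨n / 2, n % 2, by omega, by omega⟩
  have hN : (n : ℝ) + 1 ≤ 2 * ((N : ℝ) + 1) := by
    have : n + 1 ≤ 2 * (N + 1) := by omega
    exact_mod_cast this
  have hN2 : ((n : ℝ) + 1) ^ 2 ≤ 4 * (((N : ℝ) + 1) * ((N : ℝ) + 2)) := by
    have : (0 : ℝ) ≤ N := by positivity
    have : (0 : ℝ) ≤ n := by positivity
    nlinarith
  have key := binom_avg2 ε h.2.1 h.2.2.1 N (fun j => ‖z ^ j * x‖) C hx hx.nonneg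
  obtain ⟨b1, b2⟩ := h.binom hz x N
  have fin : ∀ t : ℝ, 0 ≤ t → t ≤ ∑ j ∈ Finset.range (N + 1), ε ^ j * (1 - ε) ^ (N - j) * (N.choose j) * ‖z ^ j * x‖ →
      t * ((n : ℝ) + 1) ^ 2 ≤ 4 / ε ^ 2 * C := by
    intro t ht0 ht
    rw [div_mul_eq_mul_div, le_div_iff₀ (by positivity)]
    calc t * ((n : ℝ) + 1) ^ 2 * ε ^ 2 ≤ t * (4 * (((N : ℝ) + 1) * ((N : ℝ) + 2))) * ε ^ 2 := by gcongr
      _ = 4 * (t * (ε ^ 2 * (((N : ℝ) + 1) * ((N : ℝ) + 2)))) := by ring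
      _ ≤ 4 * C := by
        refine mul_le_mul_of_nonneg_left (le_trans ?_ key) (by norm_num)
        gcongr
  constructor
  · refine fin _ (norm_nonneg _) (le_trans ?_ b1)
    rw [hk, pow_add, mul_assoc]
    exact (norm_mul_le _ _).trans (mul_le_of_le_one_left (norm_nonneg _) (pow_norm_le_one h.1 _))
  · refine fin _ (norm_nonneg _) (le_trans ?_ b2)
    rw [hk, add_comm, pow_add, ← mul_assoc]
    exact (norm_mul_le _ _).trans (mul_le_of_le_one_right (norm_nonneg _) (pow_norm_le_one h.1 _))

/-- two-sided smoothing -/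
lemma two_sided1 [NormOneClass R] {z P Q : R} {ε ε' : ℝ} (hz : ∀ y, Commute z y)
    (hP : IsSmoother z ε P) (hQ : IsSmoother z ε' Q) {x : R} {C : ℝ} (hx : Sm1 z C x) (k m : ℕ) :
    ‖P ^ k * x * Q ^ m‖ * ((k : ℝ) + m + 1) ≤ (4 / ε + 4 / ε') * C := by
  have hC := hx.nonneg
  have e0 := hP.2.1
  have e1 := hQ.2.1
  have n1 : ‖P ^ k * x * Q ^ m‖ ≤ ‖P ^ k * x‖ :=
    (norm_mul_le _ _).trans (mul_le_of_le_one_right (norm_nonneg _) (pow_norm_le_one hQ.1 _))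
  have n2 : ‖P ^ k * x * Q ^ m‖ ≤ ‖x * Q ^ m‖ := by
    rw [mul_assoc]
    exact (norm_mul_le _ _).trans (mul_le_of_le_one_left (norm_nonneg _) (pow_norm_le_one hP.1 _))
  have a1 := (hP.sm1 hz hx k).1
  have a2 := (hQ.sm1 hz hx m).2
  have b1 : ‖P ^ k * x * Q ^ m‖ * ((k : ℝ) + 1) ≤ 2 / ε * C := le_trans (by gcongr) a1
  have b2 : ‖P ^ k * x * Q ^ m‖ * ((m : ℝ) + 1) ≤ 2 / ε' * C := le_trans (by gcongr) a2
  have p1 : 0 ≤ 2 / ε * C := by positivity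
  have p2 : 0 ≤ 2 / ε' * C := by positivity
  have : (4 / ε + 4 / ε') * C = 2 * (2 / ε * C) + 2 * (2 / ε' * C) := by ring
  rw [this]
  have := norm_nonneg (P ^ k * x * Q ^ m)
  nlinarith

lemma two_sided2 [NormOneClass R] {z P Q : R} {ε ε' : ℝ} (hz : ∀ y, Commute z y)
    (hP : IsSmoother z ε P) (hQ : IsSmoother z ε' Q) {x : R} {C : ℝ} (hx : Sm2 z C x) (k m : ℕ) :
    ‖P ^ k * x * Q ^ m‖ * ((k : ℝ) + m + 1) ^ 2 ≤ (16 / ε ^ 2 + 16 / ε' ^ 2) * C := by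
  have hC := hx.nonneg
  have e0 := hP.2.1
  have e1 := hQ.2.1
  have n1 : ‖P ^ k * x * Q ^ m‖ ≤ ‖P ^ k * x‖ :=
    (norm_mul_le _ _).trans (mul_le_of_le_one_right (norm_nonneg _) (pow_norm_le_one hQ.1 _))
  have n2 : ‖P ^ k * x * Q ^ m‖ ≤ ‖x * Q ^ m‖ := by
    rw [mul_assoc]
    exact (norm_mul_le _ _).trans (mul_le_of_le_one_left (norm_nonneg _) (pow_norm_le_one hP.1 _))
  have a1 := (hP.sm2 hz hx k).1
  have a2 := (hQ.sm2 hz hx m).2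
  have b1 : ‖P ^ k * x * Q ^ m‖ * ((k : ℝ) + 1) ^ 2 ≤ 4 / ε ^ 2 * C := le_trans (by gcongr) a1
  have b2 : ‖P ^ k * x * Q ^ m‖ * ((m : ℝ) + 1) ^ 2 ≤ 4 / ε' ^ 2 * C := le_trans (by gcongr) a2
  have p1 : 0 ≤ 4 / ε ^ 2 * C := by positivity
  have p2 : 0 ≤ 4 / ε' ^ 2 * C := by positivity
  have e : (16 / ε ^ 2 + 16 / ε' ^ 2) * C = 4 * (4 / ε ^ 2 * C) + 4 * (4 / ε' ^ 2 * C) := by ring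
  rw [e]
  have q : ((k : ℝ) + m + 1) ^ 2 ≤ 4 * ((k : ℝ) + 1) ^ 2 + 4 * ((m : ℝ) + 1) ^ 2 := by
    have : (0 : ℝ) ≤ k := by positivity
    have : (0 : ℝ) ≤ m := by positivity
    nlinarith [sq_nonneg ((k : ℝ) - m)]
  calc _ ≤ ‖P ^ k * x * Q ^ m‖ * (4 * ((k : ℝ) + 1) ^ 2 + 4 * ((m : ℝ) + 1) ^ 2) := by gcongr
    _ ≤ _ := by linarith

end Smoothing

section Negligible

variable {R : Type*} [NormedRing R] [NormedAlgebra ℝ R] [NormOneClass R]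

/-- `P ^ k * x` splits into an exponentially small part and a smooth part. -/
def DecL (z : R) (P : R) (c : ℝ) (x : R) : Prop :=
  ∃ C : ℝ, 0 ≤ C ∧ ∀ k : ℕ, ∃ A B : R, P ^ k * x = A + B ∧ ‖A‖ ≤ C * c ^ k ∧ Sm1 z C B

/-- right-handed version -/
def DecR (z : R) (Q : R) (c : ℝ) (x : R) : Prop :=
  ∃ C : ℝ, 0 ≤ C ∧ ∀ k : ℕ, ∃ A B : R, x * Q ^ k = A + B ∧ ‖A‖ ≤ C * c ^ k ∧ Sm1 z C B

lemma decL_of {z P P' x η : R} {c C : ℝ} (hz : ∀ y, Commute z y) (hP : ‖P‖ ≤ 1)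
    (hP' : ‖P'‖ ≤ c) (hc : c < 1) (h : P * x = x * P' + η) (hη : Sm1 z C η) :
    DecL z P c x := by
  have hc0 : 0 ≤ c := (norm_nonneg _).trans hP'
  have hC := hη.nonneg
  have hc1 : 0 < 1 - c := by linarith
  refine ⟨‖x‖ + C / (1 - c), by positivity, fun k => ⟨x * P' ^ k, P ^ k * x - x * P' ^ k, by simp, ?_, ?_⟩⟩
  · refine (norm_mul_le _ _).trans ?_
    have : ‖P' ^ k‖ ≤ c ^ k := (norm_pow_le _ _).trans (by gcongr)
    have h2 : 0 ≤ C / (1 - c) := by positivity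
    have h3 : 0 ≤ c ^ k := by positivity
    have h4 := mul_nonneg h2 h3
    calc ‖x‖ * ‖P' ^ k‖ ≤ ‖x‖ * c ^ k := by gcongr
      _ ≤ _ := by linarith
  · have key : Sm1 z (C / (1 - c)) (P ^ k * x - x * P' ^ k) := by
      induction k with
      | zero =>
        intro j
        simp only [pow_zero, one_mul, mul_one, sub_self, mul_zero, norm_zero, zero_mul]
        positivity
      | succ k ih =>
        have e : P ^ (k + 1) * x - x * P' ^ (k + 1) = (P ^ k * x - x * P' ^ k) * P' + P ^ k * η := by
          rw [pow_succ, pow_succ, mul_assoc, h, sub_mul, mul_add, mul_assoc, mul_assoc]; abel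
        rw [e]
        refine ((ih.mul_right P').add (hη.mul_left hz (P ^ k))).mono ?_
        have h1 : C / (1 - c) * ‖P'‖ ≤ C / (1 - c) * c := by gcongr
        have h2 : ‖P ^ k‖ * C ≤ C := mul_le_of_le_one_left hC (pow_norm_le_one hP k)
        have h3 : C / (1 - c) * c + C = C / (1 - c) := by field_simp; ring
        linarith
    refine key.mono ?_
    have := norm_nonneg x
    linarith

lemma DecL.toR {z Q x : R} {c : ℝ} (hx : Commute x Q) (h : DecL z Q c x) : DecR z Q c x := by
  obtain ⟨C, hC, h⟩ := h
  refine ⟨C, hC, fun k => ?_⟩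
  rw [(hx.pow_right k).eq]
  exact h k

/-- An insertion that contributes negligibly to the telescoping sum. -/
def Neg (P Q T : R) : Prop :=
  ∃ (C : ℝ) (g : ℕ → ℝ), Summable g ∧ (∀ k, 0 ≤ g k) ∧ 0 ≤ C ∧ ∀ k m : ℕ,
    ‖P ^ k * T * Q ^ m‖ * ((k : ℝ) + m + 1) ≤ g k + g m + C / ((k : ℝ) + m + 1)

lemma Neg.add {P Q S T : R} (hS : Neg P Q S) (hT : Neg P Q T) : Neg P Q (S + T) := by
  obtain ⟨C, g, hg, hg0, hC, h⟩ := hS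
  obtain ⟨C', g', hg', hg0', hC', h'⟩ := hT
  refine ⟨C + C', fun k => g k + g' k, hg.add hg', fun k => add_nonneg (hg0 k) (hg0' k),
    add_nonneg hC hC', fun k m => ?_⟩
  have h1 := h k m
  have h2 := h' k m
  have h3 : ‖P ^ k * (S + T) * Q ^ m‖ ≤ ‖P ^ k * S * Q ^ m‖ + ‖P ^ k * T * Q ^ m‖ := by
    rw [mul_add, add_mul]; exact norm_add_le _ _
  have h4 : (0 : ℝ) ≤ (k : ℝ) + m + 1 := by positivity
  have h5 := mul_le_mul_of_nonneg_right h3 h4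
  rw [add_div]
  linarith

lemma Neg.smul {P Q T : R} (hT : Neg P Q T) (a : ℝ) : Neg P Q (a • T) := by
  obtain ⟨C, g, hg, hg0, hC, h⟩ := hT
  refine ⟨|a| * C, fun k => |a| * g k, hg.mul_left _, fun k => mul_nonneg (abs_nonneg _) (hg0 k),
    mul_nonneg (abs_nonneg _) hC, fun k m => ?_⟩
  have h1 := mul_le_mul_of_nonneg_left (h k m) (abs_nonneg a)
  rw [mul_smul_comm, smul_mul_assoc, norm_smul, Real.norm_eq_abs]
  calc _ = |a| * (‖P ^ k * T * Q ^ m‖ * ((k : ℝ) + m + 1)) := by ring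
    _ ≤ _ := h1
    _ = _ := by ring

lemma Neg.zero {P Q : R} : Neg P Q (0 : R) :=
  ⟨0, 0, summable_zero, fun _ => le_rfl, le_rfl, fun k m => by simp⟩

lemma summable_half {c : ℝ} (h0 : 0 < c) (h1 : c < 1) :
    Summable (fun k : ℕ => ((k : ℝ) + 1) * c ^ (k / 2)) := by
  have hr : 0 < √c := Real.sqrt_pos.2 h0
  have hr1 : √c < 1 := by
    rw [Real.sqrt_lt' one_pos]; simpa using h1
  have hs : Summable (fun k : ℕ => ((k : ℝ) + 1) * (√c) ^ k) := by
    have a := summable_pow_mul_geometric_of_norm_lt_one (R := ℝ) 1 (r := √c)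
      (by rw [Real.norm_of_nonneg hr.le]; exact hr1)
    have b := summable_geometric_of_lt_one hr.le hr1
    refine (a.add b).congr fun k => ?_
    ring
  refine Summable.of_nonneg_of_le (fun k => by positivity) (fun k => ?_) (hs.mul_left (√c)⁻¹)
  have : c ^ (k / 2) ≤ (√c)⁻¹ * √c ^ k := by
    rw [inv_mul_eq_div, le_div_iff₀ hr]
    have e : c ^ (k / 2) = √c ^ (2 * (k / 2)) := by rw [pow_mul, Real.sq_sqrt h0.le]
    rw [e, ← pow_succ]
    exact pow_le_pow_of_le_one hr.le hr1.le (by omega)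
  calc ((k : ℝ) + 1) * c ^ (k / 2) ≤ ((k : ℝ) + 1) * ((√c)⁻¹ * √c ^ k) := by gcongr
    _ = _ := by ring

variable {z P Q : R} {ε ε' : ℝ}

/-- insertion of type (smooth after decomposition) * (smooth) -/
lemma neg_left (hz : ∀ y, Commute z y) (hz1 : ‖z‖ ≤ 1)
    (hP : IsSmoother z ε P) (hQ : IsSmoother z ε' Q) {x X : R} {c C : ℝ} (hc0 : 0 < c) (hc1 : c < 1)
    (hx : DecL z P c x) (hX : Sm1 z C X) : Neg P Q (x * X) := by
  obtain ⟨D, hD, h⟩ := hx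
  have hC := hX.nonneg
  have e0 := hP.2.1
  have e1 := hQ.2.1
  set M := (4 / ε + 4 / ε') with hM
  set M2 := (16 / ε ^ 2 + 16 / ε' ^ 2) with hM2
  have hM0 : 0 ≤ M := by positivity
  have hM20 : 0 ≤ M2 := by positivity
  refine ⟨4 * (M2 * (8 * (D * C))), fun k => (2 * M * D * C) * (((k : ℝ) + 1) * c ^ (k / 2)),
    (summable_half hc0 hc1).mul_left _, fun k => by positivity, by positivity, fun k m => ?_⟩
  obtain ⟨A, B, hAB, hA, hB⟩ := h (k / 2)
  have hk : k = (k - k / 2) + k / 2 := by omega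
  have e : P ^ k * (x * X) * Q ^ m = P ^ (k - k / 2) * (A * X) * Q ^ m + P ^ (k - k / 2) * (B * X) * Q ^ m := by
    conv_lhs => rw [hk]
    rw [pow_add, mul_assoc (P ^ (k - k / 2)), ← mul_assoc (P ^ (k / 2)), hAB]
    noncomm_ring
  have t1 := two_sided1 hz hP hQ (hX.mul_left hz A) (k - k / 2) m
  have t2 := two_sided2 hz hP hQ (hB.mul hz hz1 hX) (k - k / 2) m
  rw [← hM] at t1
  rw [← hM2] at t2
  set a := ‖P ^ (k - k / 2) * (A * X) * Q ^ m‖ with ha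
  set b := ‖P ^ (k - k / 2) * (B * X) * Q ^ m‖ with hb
  have ha0 : 0 ≤ a := norm_nonneg _
  have hb0 : 0 ≤ b := norm_nonneg _
  set s : ℝ := ((k - k / 2 : ℕ) : ℝ) + m + 1 with hs
  have hs0 : 0 ≤ s := by positivity
  have hks : (k : ℝ) + m + 1 ≤ 2 * s := by
    have : k + m + 1 ≤ 2 * ((k - k / 2) + m + 1) := by omega
    rw [hs]
    exact_mod_cast this
  set n : ℝ := (k : ℝ) + m + 1 with hn
  have hn0 : 0 < n := by positivity
  have r1 : a * n ≤ (2 * M * D * C) * (((k : ℝ) + 1) * c ^ (k / 2)) := by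
    calc a * n ≤ a * (2 * s) := by gcongr
      _ = 2 * (a * s) := by ring
      _ ≤ 2 * (M * (‖A‖ * C)) := by gcongr
      _ ≤ 2 * (M * ((D * c ^ (k / 2)) * C)) := by gcongr
      _ = (2 * M * D * C) * (1 * c ^ (k / 2)) := by ring
      _ ≤ _ := by
        gcongr
        have : (0 : ℝ) ≤ k := by positivity
        linarith
  have r2 : b * n ≤ 4 * (M2 * (8 * (D * C))) / n := by
    rw [le_div_iff₀ hn0]
    calc b * n * n = b * n ^ 2 := by ring
      _ ≤ b * (2 * s) ^ 2 := by gcongr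
      _ = 4 * (b * s ^ 2) := by ring
      _ ≤ _ := by gcongr
  have r3 : 0 ≤ (2 * M * D * C) * (((m : ℝ) + 1) * c ^ (m / 2)) := by positivity
  rw [e]
  calc _ ≤ (a + b) * n := by gcongr; exact norm_add_le _ _
    _ ≤ _ := by linarith

lemma neg_right (hz : ∀ y, Commute z y) (hz1 : ‖z‖ ≤ 1)
    (hP : IsSmoother z ε P) (hQ : IsSmoother z ε' Q) {x X : R} {c C : ℝ} (hc0 : 0 < c) (hc1 : c < 1)
    (hx : DecR z Q c x) (hX : Sm1 z C X) : Neg P Q (X * x) := by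
  obtain ⟨D, hD, h⟩ := hx
  have hC := hX.nonneg
  have e0 := hP.2.1
  have e1 := hQ.2.1
  set M := (4 / ε + 4 / ε') with hM
  set M2 := (16 / ε ^ 2 + 16 / ε' ^ 2) with hM2
  have hM0 : 0 ≤ M := by positivity
  have hM20 : 0 ≤ M2 := by positivity
  refine ⟨4 * (M2 * (8 * (D * C))), fun k => (2 * M * D * C) * (((k : ℝ) + 1) * c ^ (k / 2)),
    (summable_half hc0 hc1).mul_left _, fun k => by positivity, by positivity, fun k m => ?_⟩
  obtain ⟨A, B, hAB, hA, hB⟩ := h (m / 2)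
  have hk : m = m / 2 + (m - m / 2) := by omega
  have e : P ^ k * (X * x) * Q ^ m = P ^ k * (X * A) * Q ^ (m - m / 2) + P ^ k * (X * B) * Q ^ (m - m / 2) := by
    conv_lhs => rw [hk]
    rw [pow_add]
    calc _ = P ^ k * X * (x * Q ^ (m / 2)) * Q ^ (m - m / 2) := by noncomm_ring
      _ = _ := by rw [hAB]; noncomm_ring
  have t1 := two_sided1 hz hP hQ (hX.mul_right A) k (m - m / 2)
  have t2 := two_sided2 hz hP hQ (hX.mul hz hz1 hB) k (m - m / 2)
  rw [← hM] at t1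
  rw [← hM2] at t2
  set a := ‖P ^ k * (X * A) * Q ^ (m - m / 2)‖ with ha
  set b := ‖P ^ k * (X * B) * Q ^ (m - m / 2)‖ with hb
  have ha0 : 0 ≤ a := norm_nonneg _
  have hb0 : 0 ≤ b := norm_nonneg _
  set s : ℝ := (k : ℝ) + ((m - m / 2 : ℕ) : ℝ) + 1 with hs
  have hs0 : 0 ≤ s := by positivity
  have hks : (k : ℝ) + m + 1 ≤ 2 * s := by
    have : k + m + 1 ≤ 2 * (k + (m - m / 2) + 1) := by omega
    rw [hs]
    exact_mod_cast this
  set n : ℝ := (k : ℝ) + m + 1 with hn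
  have hn0 : 0 < n := by positivity
  have r1 : a * n ≤ (2 * M * D * C) * (((m : ℝ) + 1) * c ^ (m / 2)) := by
    calc a * n ≤ a * (2 * s) := by gcongr
      _ = 2 * (a * s) := by ring
      _ ≤ 2 * (M * (C * ‖A‖)) := by gcongr
      _ ≤ 2 * (M * (C * (D * c ^ (m / 2)))) := by gcongr
      _ = (2 * M * D * C) * (1 * c ^ (m / 2)) := by ring
      _ ≤ _ := by
        gcongr
        have : (0 : ℝ) ≤ m := by positivity
        linarith
  have r2 : b * n ≤ 4 * (M2 * (8 * (D * C))) / n := by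
    rw [le_div_iff₀ hn0]
    calc b * n * n = b * n ^ 2 := by ring
      _ ≤ b * (2 * s) ^ 2 := by gcongr
      _ = 4 * (b * s ^ 2) := by ring
      _ ≤ 4 * (M2 * (8 * (C * D))) := by gcongr
      _ = _ := by ring
  have r3 : 0 ≤ (2 * M * D * C) * (((k : ℝ) + 1) * c ^ (k / 2)) := by positivity
  rw [e]
  calc _ ≤ (a + b) * n := by gcongr; exact norm_add_le _ _
    _ ≤ _ := by linarith

/-- insertion decomposable on both sides -/
lemma neg_both (hz : ∀ y, Commute z y) (hz1 : ‖z‖ ≤ 1)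
    (hP : IsSmoother z ε P) (hQ : IsSmoother z ε' Q) {x y : R} (X : R) {c : ℝ}
    (hc0 : 0 < c) (hc1 : c < 1)
    (hx : DecL z P c x) (hy : DecR z Q c y) : Neg P Q (x * X * y) := by
  obtain ⟨D, hD, h⟩ := hx
  obtain ⟨D', hD', h'⟩ := hy
  have e0 := hP.2.1
  have e1 := hQ.2.1
  set M := (4 / ε + 4 / ε') with hM
  set M2 := (16 / ε ^ 2 + 16 / ε' ^ 2) with hM2
  have hM0 : 0 ≤ M := by positivity
  have hM20 : 0 ≤ M2 := by positivity
  have hsum := summable_half hc0 hc1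
  set H := ∑' k : ℕ, ((k : ℝ) + 1) * c ^ (k / 2) with hH
  have hHle : ∀ k : ℕ, ((k : ℝ) + 1) * c ^ (k / 2) ≤ H := fun k =>
    hsum.le_tsum k (fun i _ => by positivity)
  have hH0 : 0 ≤ H := tsum_nonneg (fun i => by positivity)
  set E := D * ‖X‖ * D' with hE
  have hE0 : 0 ≤ E := by positivity
  refine ⟨4 * (M2 * (8 * E)), fun k => (2 * M * E + H * E) * (((k : ℝ) + 1) * c ^ (k / 2)),
    hsum.mul_left _, fun k => by positivity, by positivity, fun k m => ?_⟩
  obtain ⟨A, B, hAB, hA, hB⟩ := h (k / 2)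
  obtain ⟨A', B', hAB', hA', hB'⟩ := h' (m / 2)
  have hk : k = (k - k / 2) + k / 2 := by omega
  have hm : m = m / 2 + (m - m / 2) := by omega
  have e : P ^ k * (x * X * y) * Q ^ m
      = P ^ (k - k / 2) * (A * X * A') * Q ^ (m - m / 2)
      + P ^ (k - k / 2) * (A * X * B') * Q ^ (m - m / 2)
      + P ^ (k - k / 2) * (B * X * A') * Q ^ (m - m / 2)
      + P ^ (k - k / 2) * (B * X * B') * Q ^ (m - m / 2) := by
    have e1 : P ^ k = P ^ (k - k / 2) * P ^ (k / 2) := by rw [← pow_add, ← hk]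
    have e2 : Q ^ m = Q ^ (m / 2) * Q ^ (m - m / 2) := by rw [← pow_add, ← hm]
    rw [e1, e2]
    calc _ = P ^ (k - k / 2) * ((P ^ (k / 2) * x) * X * (y * Q ^ (m / 2))) * Q ^ (m - m / 2) := by
          simp only [mul_assoc]
      _ = _ := by rw [hAB, hAB']; simp only [mul_add, add_mul]; abel
  have t2 := two_sided1 hz hP hQ (hB'.mul_left hz (A * X)) (k - k / 2) (m - m / 2)
  have t3 := two_sided1 hz hP hQ (hB.mul_right (X * A')) (k - k / 2) (m - m / 2)
  have t4 := two_sided2 hz hP hQ ((hB.mul_right X).mul hz hz1 hB') (k - k / 2) (m - m / 2)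
  have t1 : ‖P ^ (k - k / 2) * (A * X * A') * Q ^ (m - m / 2)‖ ≤ ‖A‖ * ‖X‖ * ‖A'‖ := by
    refine (norm_mul_le _ _).trans ?_
    refine (mul_le_of_le_one_right (norm_nonneg _) (pow_norm_le_one hQ.1 _)).trans ?_
    refine (norm_mul_le _ _).trans ?_
    refine (mul_le_of_le_one_left (norm_nonneg _) (pow_norm_le_one hP.1 _)).trans ?_
    refine (norm_mul_le _ _).trans ?_
    gcongr
    exact norm_mul_le _ _
  rw [← hM] at t2 t3
  rw [← hM2] at t4
  rw [← mul_assoc B] at t3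
  set a1 := ‖P ^ (k - k / 2) * (A * X * A') * Q ^ (m - m / 2)‖ with ha1
  set a2 := ‖P ^ (k - k / 2) * (A * X * B') * Q ^ (m - m / 2)‖ with ha2
  set a3 := ‖P ^ (k - k / 2) * (B * X * A') * Q ^ (m - m / 2)‖ with ha3
  set a4 := ‖P ^ (k - k / 2) * (B * X * B') * Q ^ (m - m / 2)‖ with ha4
  have n1 : 0 ≤ a1 := norm_nonneg _
  have n2 : 0 ≤ a2 := norm_nonneg _
  have n3 : 0 ≤ a3 := norm_nonneg _
  have n4 : 0 ≤ a4 := norm_nonneg _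
  set s : ℝ := ((k - k / 2 : ℕ) : ℝ) + ((m - m / 2 : ℕ) : ℝ) + 1 with hs
  have hs0 : 0 ≤ s := by positivity
  have hks : (k : ℝ) + m + 1 ≤ 2 * s := by
    have : k + m + 1 ≤ 2 * ((k - k / 2) + (m - m / 2) + 1) := by omega
    rw [hs]
    exact_mod_cast this
  have hk0 : (0 : ℝ) ≤ k := by positivity
  have hm0 : (0 : ℝ) ≤ m := by positivity
  have hnkm : (k : ℝ) + m + 1 ≤ ((k : ℝ) + 1) * ((m : ℝ) + 1) := by nlinarith
  set n : ℝ := (k : ℝ) + m + 1 with hn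
  have hn0 : 0 < n := by positivity
  have r1 : a1 * n ≤ (H * E) * (((k : ℝ) + 1) * c ^ (k / 2)) := by
    calc a1 * n ≤ (‖A‖ * ‖X‖ * ‖A'‖) * (((k : ℝ) + 1) * ((m : ℝ) + 1)) := by gcongr
      _ ≤ ((D * c ^ (k / 2)) * ‖X‖ * (D' * c ^ (m / 2))) * (((k : ℝ) + 1) * ((m : ℝ) + 1)) := by gcongr
      _ = (((m : ℝ) + 1) * c ^ (m / 2)) * E * (((k : ℝ) + 1) * c ^ (k / 2)) := by rw [hE]; ring
      _ ≤ H * E * (((k : ℝ) + 1) * c ^ (k / 2)) := by gcongr; exact hHle m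
  have r2 : a2 * n ≤ (2 * M * E) * (((k : ℝ) + 1) * c ^ (k / 2)) := by
    calc a2 * n ≤ a2 * (2 * s) := by gcongr
      _ = 2 * (a2 * s) := by ring
      _ ≤ 2 * (M * (‖A * X‖ * D')) := by gcongr
      _ ≤ 2 * (M * ((‖A‖ * ‖X‖) * D')) := by gcongr; exact norm_mul_le _ _
      _ ≤ 2 * (M * (((D * c ^ (k / 2)) * ‖X‖) * D')) := by gcongr
      _ = (2 * M * E) * (1 * c ^ (k / 2)) := by rw [hE]; ring
      _ ≤ _ := by gcongr; linarith
  have r3 : a3 * n ≤ (2 * M * E) * (((m : ℝ) + 1) * c ^ (m / 2)) := by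
    calc a3 * n ≤ a3 * (2 * s) := by gcongr
      _ = 2 * (a3 * s) := by ring
      _ ≤ 2 * (M * (D * ‖X * A'‖)) := by gcongr
      _ ≤ 2 * (M * (D * (‖X‖ * ‖A'‖))) := by gcongr; exact norm_mul_le _ _
      _ ≤ 2 * (M * (D * (‖X‖ * (D' * c ^ (m / 2))))) := by gcongr
      _ = (2 * M * E) * (1 * c ^ (m / 2)) := by rw [hE]; ring
      _ ≤ _ := by gcongr; linarith
  have r4 : a4 * n ≤ 4 * (M2 * (8 * E)) / n := by
    rw [le_div_iff₀ hn0]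
    calc a4 * n * n = a4 * n ^ 2 := by ring
      _ ≤ a4 * (2 * s) ^ 2 := by gcongr
      _ = 4 * (a4 * s ^ 2) := by ring
      _ ≤ 4 * (M2 * (8 * (D * ‖X‖ * D'))) := by gcongr
      _ = _ := by rw [hE]
  have r5 : 0 ≤ (H * E) * (((m : ℝ) + 1) * c ^ (m / 2)) := by positivity
  rw [e]
  calc _ ≤ (a1 + a2 + a3 + a4) * n := by
        gcongr
        refine (norm_add_le _ _).trans (add_le_add ?_ le_rfl)
        refine (norm_add_le _ _).trans (add_le_add ?_ le_rfl)
        exact norm_add_le _ _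
    _ ≤ _ := by
        beta_reduce
        rw [add_mul (2 * M * E), add_mul (2 * M * E)]
        linarith

lemma telescope (P Q : R) (n : ℕ) :
    P ^ n - Q ^ n = ∑ k ∈ Finset.range n, P ^ k * (P - Q) * Q ^ (n - 1 - k) := by
  induction n with
  | zero => simp
  | succ n ih =>
    rw [Finset.sum_range_succ]
    have : ∑ k ∈ Finset.range n, P ^ k * (P - Q) * Q ^ (n + 1 - 1 - k)
        = (∑ k ∈ Finset.range n, P ^ k * (P - Q) * Q ^ (n - 1 - k)) * Q := by
      rw [Finset.sum_mul]
      refine Finset.sum_congr rfl fun k hk => ?_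
      have hk := Finset.mem_range.1 hk
      have e : n + 1 - 1 - k = (n - 1 - k) + 1 := by omega
      rw [e, pow_succ, mul_assoc, mul_assoc, mul_assoc]
    rw [this, ← ih]
    simp only [Nat.add_sub_cancel, Nat.sub_self, pow_zero, pow_succ]
    noncomm_ring

lemma tendsto_of_neg (P Q : R) (h : Neg P Q (P - Q)) :
    Tendsto (fun n => ‖P ^ n - Q ^ n‖) atTop (nhds 0) := by
  obtain ⟨C, g, hg, hg0, hC, h⟩ := h
  have key : ∀ n : ℕ, ‖P ^ n - Q ^ n‖ ≤ (2 * (∑' k, g k) + C) / n := by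
    intro n
    rcases Nat.eq_zero_or_pos n with rfl | hn
    · simp
    have hn0 : (0 : ℝ) < n := by exact_mod_cast hn
    rw [le_div_iff₀ hn0, telescope]
    calc _ ≤ (∑ k ∈ Finset.range n, ‖P ^ k * (P - Q) * Q ^ (n - 1 - k)‖) * n := by
          gcongr; exact norm_sum_le _ _
      _ = ∑ k ∈ Finset.range n, ‖P ^ k * (P - Q) * Q ^ (n - 1 - k)‖ * n := by rw [Finset.sum_mul]
      _ ≤ ∑ k ∈ Finset.range n, (g k + g (n - 1 - k) + C / n) := by
          refine Finset.sum_le_sum fun k hk => ?_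
          have hk := Finset.mem_range.1 hk
          have := h k (n - 1 - k)
          have e : (k : ℝ) + ((n - 1 - k : ℕ) : ℝ) + 1 = n := by
            have : k + (n - 1 - k) + 1 = n := by omega
            exact_mod_cast this
          rwa [e] at this
      _ = ∑ k ∈ Finset.range n, g k + ∑ k ∈ Finset.range n, g k + C := by
          rw [Finset.sum_add_distrib, Finset.sum_add_distrib, Finset.sum_range_reflect g n]
          simp
          field_simp
      _ ≤ _ := by
          have := hg.sum_le_tsum (Finset.range n) (fun k _ => hg0 k)
          linarith
  refine squeeze_zero (fun n => norm_nonneg _) key ?_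
  exact tendsto_const_div_atTop_nhds_zero_nat _

end Negligible



/-! ### The dihedral relations -/

section Dihedral

variable {R : Type*} [NormedRing R] [NormedAlgebra ℝ R] [NormOneClass R]
variable {ι : Type*} [DecidableEq ι]

/-- The abstract relations satisfied by `u = (a+b)/2`, `v = (a-b)/2`. -/
structure DihRel (u v : ι × Bool → R) (C : ℝ) : Prop where
  uu : ∀ p q, Commute (u p) (u q)
  uv : ∀ p q, p ≠ q → Commute (u p) (v q)
  vv : ∀ p q, Commute (v p) (v q)
  anti : ∀ p, v p * u p = -(u p * v p)
  sqs : ∀ p, u p * u p + v p * v p = 1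
  cen : ∀ p x, Commute (u p * u p) x
  normu : ∀ p, ‖u p‖ ≤ 1
  smooth : ∀ p (j : ℕ), ‖u p ^ j * v p‖ ^ 2 * ((j : ℝ) + 1) ≤ C
  kk : ∀ i, ‖u (i, false) * u (i, true) + v (i, false) * v (i, true)‖ ≤ 1

/-- lazy element -/
noncomputable def lz (x : R) : R := (1 / 3 : ℝ) • (1 : R) + (2 / 3 : ℝ) • x

/-- factor of the diagonal measure -/
noncomputable def kf (u v : ι × Bool → R) (i : ι) : R :=
  lz (u (i, false) * u (i, true) + v (i, false) * v (i, true))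

/-- factor of the product measure -/
noncomputable def qf (u : ι × Bool → R) (i : ι) : R := lz (u (i, false)) * lz (u (i, true))

/-- factor of `U` -/
def uf (u : ι × Bool → R) (i : ι) : R := u (i, false) * u (i, true)

lemma norm_lz {x : R} (hx : ‖x‖ ≤ 1) : ‖lz x‖ ≤ 1 := by
  unfold lz
  refine (norm_add_le _ _).trans ?_
  rw [norm_smul, norm_smul, norm_one, Real.norm_of_nonneg (by norm_num), Real.norm_of_nonneg (by norm_num)]
  linarith

lemma lz_commute {x y : R} (h : Commute x y) : Commute (lz x) y := by
  unfold lz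
  exact ((Commute.one_left y).smul_left _).add_left (h.smul_left _)

lemma list_norm_le_one (l : List ι) (f : ι → R) (h : ∀ i, ‖f i‖ ≤ 1) : ‖(l.map f).prod‖ ≤ 1 := by
  induction l with
  | nil => simp
  | cons i l ih =>
    rw [List.map_cons, List.prod_cons]
    exact (norm_mul_le _ _).trans (mul_le_one₀ (h i) (norm_nonneg _) ih)

lemma list_commute (l : List ι) (f : ι → R) (y : R) (h : ∀ i ∈ l, Commute (f i) y) :
    Commute (l.map f).prod y := by
  induction l with
  | nil => simp
  | cons i l ih =>
    rw [List.map_cons, List.prod_cons]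
    exact (h i (by simp)).mul_left (ih fun j hj => h j (by simp [hj]))

lemma list_dominate (l : List ι) (f g : ι → R) (a : ℝ) (ha : 0 ≤ a) (_ha1 : a ≤ 1)
    (hf : ∀ i, ‖f i‖ ≤ 1) (hg : ∀ i, ‖g i‖ ≤ 1) (h : ∀ i, ‖f i - a • g i‖ ≤ 1 - a) :
    ‖(l.map f).prod - a ^ l.length • (l.map g).prod‖ ≤ 1 - a ^ l.length := by
  induction l with
  | nil => simp
  | cons i l ih =>
    rw [List.map_cons, List.prod_cons, List.map_cons, List.prod_cons, List.length_cons]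
    set F := (l.map f).prod
    set G := (l.map g).prod
    set A := a ^ l.length
    have e : f i * F - a ^ (l.length + 1) • (g i * G) = (f i - a • g i) * F + (a • g i) * (F - A • G) := by
      simp only [sub_mul, mul_sub, smul_mul_assoc, mul_smul_comm, smul_smul, A, pow_succ]
      abel
    have h1 : ‖(f i - a • g i) * F‖ ≤ 1 - a := by
      refine (norm_mul_le _ _).trans ?_
      exact (mul_le_of_le_one_right (norm_nonneg _) (list_norm_le_one l f hf)).trans (h i)
    have h2 : ‖(a • g i) * (F - A • G)‖ ≤ a * (1 - A) := by
      refine (norm_mul_le _ _).trans ?_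
      rw [norm_smul, Real.norm_of_nonneg ha]
      have := hg i
      calc a * ‖g i‖ * ‖F - A • G‖ ≤ a * 1 * (1 - A) := by gcongr
        _ = _ := by ring
    rw [e, pow_succ]
    refine (norm_add_le _ _).trans ?_
    simp only [A] at h2 ⊢
    linarith

namespace DihRel

variable {u v : ι × Bool → R} {C : ℝ}

lemma norm_uf (h : DihRel u v C) (i : ι) : ‖uf u i‖ ≤ 1 :=
  (norm_mul_le _ _).trans (mul_le_one₀ (h.normu _) (norm_nonneg _) (h.normu _))

lemma norm_qf (h : DihRel u v C) (i : ι) : ‖qf u i‖ ≤ 1 :=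
  (norm_mul_le _ _).trans (mul_le_one₀ (norm_lz (h.normu _)) (norm_nonneg _) (norm_lz (h.normu _)))

lemma norm_kf (h : DihRel u v C) (i : ι) : ‖kf u v i‖ ≤ 1 := norm_lz (h.kk i)

lemma uf_comm (h : DihRel u v C) (i : ι) (p : ι × Bool) : Commute (uf u i) (u p) := (h.uu _ _).mul_left (h.uu _ _)

lemma qf_comm (h : DihRel u v C) (i : ι) (p : ι × Bool) : Commute (qf u i) (u p) :=
  (lz_commute (h.uu _ _)).mul_left (lz_commute (h.uu _ _))

lemma kf_comm (h : DihRel u v C) (i : ι) (p : ι × Bool) (hp : p.1 ≠ i) : Commute (kf u v i) (u p) := by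
  refine lz_commute ?_
  refine ((h.uu _ _).mul_left (h.uu _ _)).add_left (Commute.mul_left ?_ ?_)
  · exact (h.uv _ _ (by rintro rfl; exact hp rfl)).symm
  · exact (h.uv _ _ (by rintro rfl; exact hp rfl)).symm

lemma qf_dom (h : DihRel u v C) (i : ι) : ‖qf u i - (4 / 9 : ℝ) • uf u i‖ ≤ 1 - 4 / 9 := by
  have e : qf u i - (4 / 9 : ℝ) • uf u i = (1 / 9 : ℝ) • (1 : R) + (2 / 9 : ℝ) • u (i, false) + (2 / 9 : ℝ) • u (i, true) := by
    simp only [qf, uf, lz, add_mul, mul_add, smul_mul_assoc, mul_smul_comm, one_mul, mul_one]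
    module
  rw [e]
  refine (norm_add_le _ _).trans ((add_le_add (norm_add_le _ _) le_rfl).trans ?_)
  rw [norm_smul, norm_smul, norm_smul, norm_one, Real.norm_of_nonneg (by norm_num), Real.norm_of_nonneg (by norm_num)]
  have := h.normu (i, false)
  have := h.normu (i, true)
  linarith

/-- squares of products of the `u`'s are central -/
lemma U_sq_central (h : DihRel u v C) (l : List ι) (x : R) :
    Commute ((l.map (uf u)).prod * (l.map (uf u)).prod) x := by
  induction l with
  | nil => simp
  | cons i l ih =>
    rw [List.map_cons, List.prod_cons]
    have c1 : Commute (uf u i) (l.map (uf u)).prod :=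
      (list_commute l (uf u) (uf u i) fun j _ => (h.uf_comm j _).mul_right (h.uf_comm j _)).symm
    rw [c1.symm.mul_mul_mul_comm]
    refine Commute.mul_left ?_ ih
    unfold uf
    rw [(h.uu (i, true) (i, false)).mul_mul_mul_comm]
    exact (h.cen _ _).mul_left (h.cen _ _)

lemma v_u_pow (h : DihRel u v C) (p : ι × Bool) (j : ℕ) : v p * u p ^ j = (-1) ^ j * (u p ^ j * v p) := by
  induction j with
  | zero => simp
  | succ j ih =>
    rw [pow_succ (u p), ← mul_assoc, ih, mul_assoc, mul_assoc, h.anti, pow_succ]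
    simp [mul_assoc]

lemma smooth_vv (h : DihRel u v C) (p : ι × Bool) (j : ℕ) : ‖u p ^ (2 * j) * (v p * v p)‖ * ((j : ℝ) + 1) ≤ C := by
  have e : u p ^ (2 * j) * (v p * v p) = (-1) ^ j * ((u p ^ j * v p) * (u p ^ j * v p)) := by
    have h1 := h.v_u_pow p j
    have h2 : (u p ^ j * v p) * (u p ^ j * v p) = (-1) ^ j * (u p ^ (2 * j) * (v p * v p)) := by
      calc _ = u p ^ j * (v p * u p ^ j) * v p := by simp only [mul_assoc]
        _ = u p ^ j * ((-1) ^ j * (u p ^ j * v p)) * v p := by rw [h1]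
        _ = _ := by
          rw [((Commute.neg_one_right (u p ^ j)).pow_right j).left_comm, two_mul, pow_add]
          simp only [mul_assoc]
    rw [h2, ← mul_assoc ((-1 : R) ^ j) ((-1) ^ j), ← pow_add, Even.neg_one_pow ⟨j, rfl⟩, one_mul]
  have h3 : ‖u p ^ (2 * j) * (v p * v p)‖ ≤ ‖u p ^ j * v p‖ ^ 2 := by
    rw [e, sq]
    refine (norm_mul_le _ _).trans ?_
    refine (mul_le_of_le_one_left (norm_nonneg _) (pow_norm_le_one (by simp) _)).trans (norm_mul_le _ _)
  have := h.smooth p j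
  have h4 : (0 : ℝ) ≤ (j : ℝ) + 1 := by positivity
  nlinarith

lemma C_nonneg (h : DihRel u v C) (p : ι × Bool) : 0 ≤ C := le_trans (by positivity) (h.smooth p 0)

lemma smooth_w (h : DihRel u v C) (i : ι) (j : ℕ) : ‖u (i, false) ^ (2 * j) * u (i, true) ^ (2 * j) * (v (i, false) * v (i, true))‖ * ((j : ℝ) + 1) ≤ C := by
  have e : u (i, false) ^ (2 * j) * u (i, true) ^ (2 * j) * (v (i, false) * v (i, true))
    = (u (i, false) ^ (2 * j) * v (i, false)) * (u (i, true) ^ (2 * j) * v (i, true)) :=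
    Commute.mul_mul_mul_comm ((h.uv _ _ (by simp)).pow_left _) _ _
  rw [e]
  have h1 := h.smooth (i, false) (2 * j)
  have h2 := h.smooth (i, true) (2 * j)
  set a := ‖u (i, false) ^ (2 * j) * v (i, false)‖
  set b := ‖u (i, true) ^ (2 * j) * v (i, true)‖
  have h3 : ‖(u (i, false) ^ (2 * j) * v (i, false)) * (u (i, true) ^ (2 * j) * v (i, true))‖ ≤ a * b := norm_mul_le _ _
  have h4 : a * b ≤ (a ^ 2 + b ^ 2) / 2 := by nlinarith [sq_nonneg (a - b)]
  push_cast at h1 h2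
  have hj : (0 : ℝ) ≤ j := by positivity
  calc _ ≤ ((a ^ 2 + b ^ 2) / 2) * ((j : ℝ) + 1) := by gcongr; exact h3.trans h4
    _ ≤ ((a ^ 2 + b ^ 2) / 2) * (2 * (j : ℝ) + 1) := by gcongr; linarith
    _ ≤ C := by linarith

lemma z_pow (h : DihRel u v C) (l : List ι) (i : ι) (hi : i ∈ l) (j : ℕ) : ∃ Y : R, ‖Y‖ ≤ 1 ∧
    ((l.map (uf u)).prod * (l.map (uf u)).prod) ^ j = Y * (u (i, false) ^ (2 * j) * u (i, true) ^ (2 * j)) := by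
  obtain ⟨l1, l2, rfl⟩ := List.append_of_mem hi
  set L1 := (l1.map (uf u)).prod with hL1
  set L2 := (l2.map (uf u)).prod with hL2
  have n1 : ‖L1‖ ≤ 1 := list_norm_le_one _ _ h.norm_uf
  have n2 : ‖L2‖ ≤ 1 := list_norm_le_one _ _ h.norm_uf
  have c2 : Commute (uf u i) L2 :=
    (list_commute l2 (uf u) (uf u i) fun j _ => (h.uf_comm j _).mul_right (h.uf_comm j _)).symm
  have c1 : Commute (uf u i) L1 :=
    (list_commute l1 (uf u) (uf u i) fun j _ => (h.uf_comm j _).mul_right (h.uf_comm j _)).symm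
  refine ⟨(L1 * L2) ^ (2 * j), pow_norm_le_one ?_ _, ?_⟩
  · exact (norm_mul_le _ _).trans (mul_le_one₀ n1 (norm_nonneg _) n2)
  · rw [List.map_append, List.prod_append, List.map_cons, List.prod_cons, ← hL1, ← hL2, ← sq,
      ← pow_mul, c2.eq, ← mul_assoc, (c1.mul_right c2).symm.mul_pow]
    unfold uf
    rw [(h.uu _ _).mul_pow]

lemma sm_vv (h : DihRel u v C) (l : List ι) (p : ι × Bool) (hi : p.1 ∈ l) :
    Sm1 ((l.map (uf u)).prod * (l.map (uf u)).prod) C (v p * v p) := by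
  intro j
  obtain ⟨Y, hY, e⟩ := h.z_pow l p.1 hi j
  rw [e]
  refine le_trans ?_ (h.smooth_vv p j)
  gcongr
  obtain ⟨i, b⟩ := p
  have : ∃ Y' : R, ‖Y'‖ ≤ 1 ∧ Y * (u (i, false) ^ (2 * j) * u (i, true) ^ (2 * j)) = Y' * u (i, b) ^ (2 * j) := by
    cases b
    · refine ⟨Y * u (i, true) ^ (2 * j), ?_, ?_⟩
      · exact (norm_mul_le _ _).trans (mul_le_one₀ hY (norm_nonneg _) (pow_norm_le_one (h.normu _) _))
      · rw [((h.uu (i, false) (i, true)).pow_pow _ _).eq, mul_assoc]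
    · refine ⟨Y * u (i, false) ^ (2 * j), ?_, ?_⟩
      · exact (norm_mul_le _ _).trans (mul_le_one₀ hY (norm_nonneg _) (pow_norm_le_one (h.normu _) _))
      · rw [mul_assoc]
  obtain ⟨Y', hY', e'⟩ := this
  rw [e', mul_assoc]
  exact (norm_mul_le _ _).trans (mul_le_of_le_one_left (norm_nonneg _) hY')

lemma sm_w (h : DihRel u v C) (l : List ι) (i : ι) (hi : i ∈ l) :
    Sm1 ((l.map (uf u)).prod * (l.map (uf u)).prod) C (v (i, false) * v (i, true)) := by
  intro j
  obtain ⟨Y, hY, e⟩ := h.z_pow l i hi j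
  rw [e]
  refine le_trans ?_ (h.smooth_w i j)
  gcongr
  rw [mul_assoc]
  exact (norm_mul_le _ _).trans (mul_le_of_le_one_left (norm_nonneg _) hY)

/-- the noise element is smoothing -/
lemma smoother (h : DihRel u v C) (l : List ι) (ρ : ℝ) (h0 : 0 < ρ) (h1 : ρ ≤ 1) :
    ∃ ε : ℝ, IsSmoother ((l.map (uf u)).prod * (l.map (uf u)).prod) ε
      ((1 - ρ) • (l.map (kf u v)).prod + ρ • (l.map (qf u)).prod) := by
  set K := (l.map (kf u v)).prod
  set Q := (l.map (qf u)).prod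
  set U := (l.map (uf u)).prod
  have nK : ‖K‖ ≤ 1 := list_norm_le_one _ _ h.norm_kf
  have nQ : ‖Q‖ ≤ 1 := list_norm_le_one _ _ h.norm_qf
  have nU : ‖U‖ ≤ 1 := list_norm_le_one _ _ h.norm_uf
  have dom := list_dominate l (qf u) (uf u) (4 / 9) (by norm_num) (by norm_num) h.norm_qf h.norm_uf h.qf_dom
  set A : ℝ := (4 / 9) ^ l.length with hA
  have A0 : 0 < A := by positivity
  have A1 : A ≤ 1 := pow_le_one₀ (by norm_num) (by norm_num)
  set P := (1 - ρ) • K + ρ • Q with hP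
  set W := P - (ρ * A) • U with hW
  have nW : ‖W‖ ≤ 1 - ρ * A := by
    have : W = (1 - ρ) • K + ρ • (Q - A • U) := by
      rw [hW, hP, smul_sub, smul_smul]; abel
    rw [this]
    refine (norm_add_le _ _).trans ?_
    rw [norm_smul, norm_smul, Real.norm_of_nonneg (by linarith), Real.norm_of_nonneg h0.le]
    nlinarith
  have hρA : 0 < ρ * A := by positivity
  have hρA1 : ρ * A ≤ 1 := by nlinarith
  have nP : ‖P‖ ≤ 1 := by
    have : P = W + (ρ * A) • U := by rw [hW]; abel
    rw [this]
    refine (norm_add_le _ _).trans ?_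
    rw [norm_smul, Real.norm_of_nonneg hρA.le]
    nlinarith
  -- shrink so that we never divide by zero
  set δ := ρ * A / 2 with hδ
  have hd0 : 0 < δ := by positivity
  have hd1 : δ < 1 := by linarith
  have nW' : ‖P - δ • U‖ ≤ 1 - δ := by
    have : P - δ • U = W + δ • U := by
      have : (ρ * A) = δ + δ := by rw [hδ]; ring
      rw [hW, this, add_smul]; abel
    rw [this]
    refine (norm_add_le _ _).trans ?_
    rw [norm_smul, Real.norm_of_nonneg hd0.le]
    nlinarith
  have hε : 0 < 1 - δ ^ 2 := by nlinarith
  refine ⟨δ ^ 2, nP, by positivity, by nlinarith, (1 - δ ^ 2)⁻¹ • (P * P - δ ^ 2 • (U * U)), ?_, ?_⟩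
  · rw [norm_smul, Real.norm_of_nonneg (by positivity), inv_mul_le_iff₀ hε, mul_one]
    have e : P * P - δ ^ 2 • (U * U) = (P - δ • U) * P + δ • (U * (P - δ • U)) := by
      simp only [sub_mul, mul_sub, smul_mul_assoc, mul_smul_comm, smul_sub, smul_smul, sq]
      abel
    rw [e]
    refine (norm_add_le _ _).trans ?_
    rw [norm_smul, Real.norm_of_nonneg hd0.le]
    have a1 : ‖(P - δ • U) * P‖ ≤ 1 - δ :=
      (norm_mul_le _ _).trans ((mul_le_of_le_one_right (norm_nonneg _) nP).trans nW')
    have a2 : ‖U * (P - δ • U)‖ ≤ 1 - δ :=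
      (norm_mul_le _ _).trans ((mul_le_of_le_one_left (norm_nonneg _) nU).trans nW')
    nlinarith
  · rw [smul_smul, mul_inv_cancel₀ hε.ne', one_smul]; abel

end DihRel

end Dihedral



section Main

variable {R : Type*} [NormedRing R] [NormedAlgebra ℝ R] [NormOneClass R]
variable {ι : Type*} [DecidableEq ι]

namespace DihRel

variable {u v : ι × Bool → R} {C : ℝ}

lemma kf_eq (h : DihRel u v C) (p : ι × Bool) :
    kf u v p.1 = lz (u p * u (p.1, !p.2) + v p * v (p.1, !p.2)) := by
  obtain ⟨i, b⟩ := p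
  cases b
  · rfl
  · simp only [kf, Bool.not_true]
    rw [(h.uu (i, true) (i, false)).eq, (h.vv (i, true) (i, false)).eq]

lemma qf_eq (h : DihRel u v C) (p : ι × Bool) :
    qf u p.1 = lz (u (p.1, !p.2)) * lz (u p) := by
  obtain ⟨i, b⟩ := p
  cases b
  · simp only [qf, Bool.not_false]
    exact (lz_commute (lz_commute (h.uu (i, true) (i, false))).symm).eq
  · rfl

lemma kf_one_sub (h : DihRel u v C) (p : ι × Bool) :
    kf u v p.1 * (1 - u p) = (1 - u p) * ((1 / 3 : ℝ) • (1 : R) - (2 / 3 : ℝ) • u (p.1, !p.2)) +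
      (2 / 3 : ℝ) • ((v p * v p) * u (p.1, !p.2) + v p * v (p.1, !p.2) * (1 - u p)) := by
  rw [h.kf_eq p]
  have hs : v p * v p = 1 - u p * u p := by rw [← h.sqs p]; abel
  have hc := (h.uu (p.1, !p.2) p).eq
  have e : u p * u (p.1, !p.2) * u p = u p * u p * u (p.1, !p.2) := by
    rw [mul_assoc, hc, mul_assoc]
  rw [hs]
  simp only [lz, add_mul, sub_mul, mul_sub, smul_mul_assoc, mul_smul_comm, one_mul, mul_one, e]
  module

lemma qf_one_sub (h : DihRel u v C) (p : ι × Bool) :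
    qf u p.1 * (1 - u p) = (1 - u p) * ((-(1 / 3) : ℝ) • lz (u (p.1, !p.2))) +
      (2 / 3 : ℝ) • (lz (u (p.1, !p.2)) * (v p * v p)) := by
  rw [h.qf_eq p]
  have hs : v p * v p = 1 - u p * u p := by rw [← h.sqs p]; abel
  have hc := (lz_commute (h.uu (p.1, !p.2) p)).eq
  have e : (1 - u p) * lz (u (p.1, !p.2)) = lz (u (p.1, !p.2)) * (1 - u p) := by
    rw [sub_mul, mul_sub, hc, one_mul, mul_one]
  rw [mul_smul_comm, e, hs, mul_assoc, ← mul_smul_comm, ← mul_smul_comm, ← mul_add]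
  congr 1
  simp only [lz, add_mul, mul_sub, smul_mul_assoc, one_mul, mul_one]
  module

/-- abbreviation for the noise element -/
lemma dec (h : DihRel u v C) (l : List ι) (hl : l.Nodup) (ρ c : ℝ) (h0 : 0 < ρ) (h1 : ρ ≤ 1)
    (hc : 1 - 2 / 3 * ρ ≤ c) (hc1 : c < 1) (p : ι × Bool) (hp : p.1 ∈ l) :
    DecL ((l.map (uf u)).prod * (l.map (uf u)).prod)
      ((1 - ρ) • (l.map (kf u v)).prod + ρ • (l.map (qf u)).prod) c (1 - u p) := by
  have hz := h.U_sq_central l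
  obtain ⟨ε, hsm⟩ := h.smoother l ρ h0 h1
  have hvv := h.sm_vv l p hp
  have hw := h.sm_w l p.1 hp
  have hw' : v (p.1, false) * v (p.1, true) = v p * v (p.1, !p.2) := by
    obtain ⟨i, b⟩ := p
    cases b
    · rfl
    · exact (h.vv _ _).eq
  rw [hw'] at hw
  obtain ⟨l1, l2, rfl⟩ := List.append_of_mem hp
  have hn1 : p.1 ∉ l1 := by
    intro hh
    exact (List.disjoint_of_nodup_append hl) hh (by simp)
  have hn2 : p.1 ∉ l2 := by
    have := (List.nodup_append.1 hl).2.1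
    exact (List.nodup_cons.1 this).1
  set z := ((List.map (uf u) (l1 ++ p.1 :: l2)).prod * (List.map (uf u) (l1 ++ p.1 :: l2)).prod)
  have nP := hsm.1
  set P := (1 - ρ) • (List.map (kf u v) (l1 ++ p.1 :: l2)).prod + ρ • (List.map (qf u) (l1 ++ p.1 :: l2)).prod with hP
  rw [List.map_append, List.prod_append, List.map_cons, List.prod_cons,
    List.map_append, List.prod_append, List.map_cons, List.prod_cons] at hP
  set A := (l1.map (kf u v)).prod
  set B := (l2.map (kf u v)).prod
  set A' := (l1.map (qf u)).prod
  set B' := (l2.map (qf u)).prod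
  have nA : ‖A‖ ≤ 1 := list_norm_le_one _ _ h.norm_kf
  have nB : ‖B‖ ≤ 1 := list_norm_le_one _ _ h.norm_kf
  have nA' : ‖A'‖ ≤ 1 := list_norm_le_one _ _ h.norm_qf
  have nB' : ‖B'‖ ≤ 1 := list_norm_le_one _ _ h.norm_qf
  have one_sub : ∀ {x : R}, Commute x (u p) → Commute x (1 - u p) := fun hx =>
    (Commute.one_right _).sub_right hx
  have cA : Commute A (1 - u p) := one_sub
    (list_commute _ _ _ fun i hi => h.kf_comm i p (by rintro rfl; exact hn1 hi))
  have cB : Commute B (1 - u p) := one_sub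
    (list_commute _ _ _ fun i hi => h.kf_comm i p (by rintro rfl; exact hn2 hi))
  have cA' : Commute A' (1 - u p) := one_sub (list_commute _ _ _ fun i hi => h.qf_comm i p)
  have cB' : Commute B' (1 - u p) := one_sub (list_commute _ _ _ fun i hi => h.qf_comm i p)
  set x := 1 - u p with hx
  set u' := u (p.1, !p.2)
  set k' := (1 / 3 : ℝ) • (1 : R) - (2 / 3 : ℝ) • u' with hk'
  set η₁ := (2 / 3 : ℝ) • ((v p * v p) * u' + v p * v (p.1, !p.2) * x)
  set q' := (-(1 / 3) : ℝ) • lz u' with hq'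
  set η₂ := (2 / 3 : ℝ) • (lz u' * (v p * v p))
  have e1 : kf u v p.1 * x = x * k' + η₁ := h.kf_one_sub p
  have e2 : qf u p.1 * x = x * q' + η₂ := h.qf_one_sub p
  have s1 := ((hvv.mul_right u').add (hw.mul_right x)).smul (2 / 3)
  have s2 := (hvv.mul_left hz (lz u')).smul (2 / 3)
  have s3 := (((s1.mul_left hz A).mul_right B).smul (1 - ρ)).add (((s2.mul_left hz A').mul_right B').smul ρ)
  have nk' : ‖k'‖ ≤ 1 := by
    refine (norm_sub_le _ _).trans ?_
    rw [norm_smul, norm_smul, norm_one, Real.norm_of_nonneg (by norm_num), Real.norm_of_nonneg (by norm_num)]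
    have := h.normu (p.1, !p.2)
    linarith
  have nq' : ‖q'‖ ≤ 1 / 3 := by
    rw [hq', norm_smul, Real.norm_eq_abs, abs_neg, abs_of_nonneg (by norm_num)]
    have := norm_lz (h.normu (p.1, !p.2))
    linarith
  refine decL_of (P' := (1 - ρ) • (A * k' * B) + ρ • (A' * q' * B')) hz nP ?_ hc1 ?_ s3
  · refine le_trans ?_ hc
    refine (norm_add_le _ _).trans ?_
    rw [norm_smul, norm_smul, Real.norm_of_nonneg (by linarith), Real.norm_of_nonneg h0.le]
    have b1 : ‖A * k' * B‖ ≤ 1 :=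
      (norm_mul_le _ _).trans (mul_le_one₀
        ((norm_mul_le _ _).trans (mul_le_one₀ nA (norm_nonneg _) nk')) (norm_nonneg _) nB)
    have b2 : ‖A' * q' * B'‖ ≤ 1 / 3 := by
      refine (norm_mul_le _ _).trans (le_trans (mul_le_of_le_one_right (norm_nonneg _) nB') ?_)
      exact (norm_mul_le _ _).trans (le_trans (mul_le_of_le_one_left (norm_nonneg _) nA') nq')
    nlinarith
  · have f1 : A * (kf u v p.1 * B) * x = x * (A * k' * B) + A * η₁ * B := by
      calc _ = A * (kf u v p.1 * (B * x)) := by simp only [mul_assoc]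
        _ = A * ((kf u v p.1 * x) * B) := by rw [cB.eq]; simp only [mul_assoc]
        _ = A * x * (k' * B) + A * η₁ * B := by rw [e1, add_mul, mul_add]; simp only [mul_assoc]
        _ = _ := by rw [cA.eq]; simp only [mul_assoc]
    have f2 : A' * (qf u p.1 * B') * x = x * (A' * q' * B') + A' * η₂ * B' := by
      calc _ = A' * (qf u p.1 * (B' * x)) := by simp only [mul_assoc]
        _ = A' * ((qf u p.1 * x) * B') := by rw [cB'.eq]; simp only [mul_assoc]
        _ = A' * x * (q' * B') + A' * η₂ * B' := by rw [e2, add_mul, mul_add]; simp only [mul_assoc]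
        _ = _ := by rw [cA'.eq]; simp only [mul_assoc]
    have f3 : ∀ S T : R, x * ((1 - ρ) • S + ρ • T) = (1 - ρ) • (x * S) + ρ • (x * T) := by
      intro S T
      rw [mul_add, mul_smul_comm, mul_smul_comm]
    rw [hP, add_mul, smul_mul_assoc, smul_mul_assoc, f1, f2, f3, smul_add, smul_add]
    exact add_add_add_comm _ _ _ _

lemma kf_sub_qf (_h : DihRel u v C) (i : ι) : kf u v i - qf u i =
    (2 / 9 : ℝ) • ((1 - u (i, false)) * (1 - u (i, true))) +
      (2 / 3 : ℝ) • (v (i, false) * v (i, true)) := by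
  simp only [kf, qf, lz, add_mul, mul_add, sub_mul, mul_sub, smul_mul_assoc, mul_smul_comm, one_mul, mul_one]
  module

lemma neg_tel (h : DihRel u v C) (L : List ι) (hL : L.Nodup) (ρ : ℝ) (h0 : 0 < ρ) (h1 : ρ ≤ 1)
    (l l0 : List ι) (hl : l0 ++ l = L) :
    Neg ((1 - ρ) • (L.map (kf u v)).prod + ρ • (L.map (qf u)).prod) (L.map (qf u)).prod
      ((l0.map (kf u v)).prod * ((l.map (kf u v)).prod - (l.map (qf u)).prod)) := by
  induction l generalizing l0 with
  | nil => simpa using Neg.zero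
  | cons i l ih =>
    have key := ih (l0 ++ [i]) (by simp [← hl])
    have hi : i ∈ L := by simp [← hl]
    have hn : i ∉ l0 := by
      subst hl
      intro hh
      exact (List.disjoint_of_nodup_append hL) hh (by simp)
    have hz := h.U_sq_central L
    obtain ⟨ε, hP⟩ := h.smoother L ρ h0 h1
    obtain ⟨ε', hQ⟩ := h.smoother L 1 one_pos le_rfl
    have nU : ‖(L.map (uf u)).prod‖ ≤ 1 := list_norm_le_one _ _ h.norm_uf
    have nz : ‖(L.map (uf u)).prod * (L.map (uf u)).prod‖ ≤ 1 :=
      (norm_mul_le _ _).trans (mul_le_one₀ nU (norm_nonneg _) nU)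
    have hc1 : 1 - 2 / 3 * ρ < 1 := by linarith
    have hc0 : 0 < 1 - 2 / 3 * ρ := by linarith
    have dP := fun b => h.dec L hL ρ _ h0 h1 le_rfl hc1 (i, b) hi
    have dQ := fun b => h.dec L hL 1 (1 - 2 / 3 * ρ) one_pos le_rfl (by linarith) hc1 (i, b) hi
    have hw := h.sm_w L i hi
    simp only [sub_self, zero_smul, one_smul, zero_add] at hQ dQ
    set z := (L.map (uf u)).prod * (L.map (uf u)).prod
    set P := (1 - ρ) • (L.map (kf u v)).prod + ρ • (L.map (qf u)).prod
    set Q := (L.map (qf u)).prod with hQd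
    rw [List.map_append, List.prod_append, List.map_singleton, List.prod_singleton] at key
    rw [List.map_cons, List.prod_cons, List.map_cons, List.prod_cons]
    set X := (l0.map (kf u v)).prod
    set K' := (l.map (kf u v)).prod
    set Q' := (l.map (qf u)).prod
    have one_sub : ∀ {x : R} {b : Bool}, Commute x (u (i, b)) → Commute x (1 - u (i, b)) := fun hx =>
      (Commute.one_right _).sub_right hx
    have cX : ∀ b, Commute X (u (i, b)) := fun b =>
      (list_commute _ _ _ fun j hj => h.kf_comm j (i, b) (by rintro rfl; exact hn hj))
    have cQ' : ∀ b, Commute Q' (u (i, b)) := fun b => (list_commute _ _ _ fun j hj => h.qf_comm j _)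
    have cQ : ∀ b, Commute Q (u (i, b)) := fun b => (list_commute _ _ _ fun j hj => h.qf_comm j _)
    set w := v (i, false) * v (i, true) with hwd
    have hwu : w * u (i, false) = - (u (i, false) * w) := by
      rw [hwd, mul_assoc, (h.uv (i, false) (i, true) (by simp)).symm.eq, ← mul_assoc, h.anti]
      simp [mul_assoc]
    have dQR := fun b => (dQ b).toR (one_sub (cQ b)).symm
    have t1 := neg_both hz nz hP hQ (X * Q') hc0 hc1 (dP false) (dQR true)
    have sX := (hw.mul_left hz X).mul_right Q'
    have t2 := neg_left hz nz hP hQ hc0 hc1 (dP false) sX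
    have t3 := neg_right hz nz hP hQ hc0 hc1 (dQR false) sX
    have e : X * (kf u v i * K' - qf u i * Q') = X * kf u v i * (K' - Q') +
        ((2 / 9 : ℝ) • ((1 - u (i, false)) * (X * Q') * (1 - u (i, true))) +
        ((1 / 3 : ℝ) • ((1 - u (i, false)) * (X * w * Q')) + (1 / 3 : ℝ) • (X * w * Q' * (1 - u (i, false))))) := by
      have e1 : (1 - u (i, false)) * (X * Q') * (1 - u (i, true))
          = X * ((1 - u (i, false)) * (1 - u (i, true))) * Q' := by
        rw [mul_assoc, mul_assoc X Q', (one_sub (cQ' true)).eq]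
        rw [← mul_assoc, (one_sub (cX false)).symm.eq]
        simp only [mul_assoc]
      have e2 : (1 - u (i, false)) * (X * w * Q') + (X * w * Q' * (1 - u (i, false))) = (2 : ℝ) • (X * w * Q') := by
        have : X * w * Q' * u (i, false) = - (u (i, false) * (X * w * Q')) := by
          rw [mul_assoc, (cQ' false).eq, ← mul_assoc, mul_assoc X, hwu, mul_neg, ← mul_assoc, (cX false).eq]
          simp only [neg_mul, mul_assoc]
        rw [sub_mul, mul_sub, this]
        rw [one_mul, mul_one, two_smul]; abel
      rw [← smul_add, e1, e2, smul_smul]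
      have e3 := h.kf_sub_qf i
      have : X * (kf u v i * K' - qf u i * Q') = X * kf u v i * (K' - Q') + X * (kf u v i - qf u i) * Q' := by
        simp only [mul_sub, sub_mul, mul_assoc]; abel
      rw [this, e3]
      simp only [mul_add, add_mul, mul_smul_comm, smul_mul_assoc]
      norm_num
      rfl
    rw [e]
    exact key.add ((t1.smul _).add ((t2.smul _).add (t3.smul _)))

theorem main (h : DihRel u v C) (L : List ι) (hL : L.Nodup) (ρ : ℝ) (h0 : 0 < ρ) (h1 : ρ ≤ 1) :
    Tendsto (fun n => ‖((1 - ρ) • (L.map (kf u v)).prod + ρ • (L.map (qf u)).prod) ^ n -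
      (L.map (qf u)).prod ^ n‖) atTop (nhds 0) := by
  refine tendsto_of_neg _ _ ?_
  have t := (h.neg_tel L hL ρ h0 h1 L [] rfl).smul (1 - ρ)
  simp only [List.map_nil, List.prod_nil, one_mul] at t
  convert t using 1
  module

end DihRel

end Main



section Binomial

variable {R : Type*} [NormedRing R] [NormedAlgebra ℝ R] [NormOneClass R]

lemma one_add_pow_mul_one_sub (t : R) (N : ℕ) :
    (1 + t) ^ N * (1 - t) = 1 + ∑ k ∈ Finset.range N, ((N.choose (k + 1) : ℝ) - N.choose k) • t ^ (k + 1)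
      - t ^ (N + 1) := by
  have e : (1 + t) ^ N = ∑ k ∈ Finset.range (N + 1), (N.choose k : ℝ) • t ^ k := by
    rw [add_comm, (Commute.one_right t).add_pow]
    refine Finset.sum_congr rfl fun k _ => ?_
    rw [one_pow, mul_one, ← nsmul_eq_mul', Nat.cast_smul_eq_nsmul]
  rw [mul_sub, mul_one, e]
  conv_lhs => rw [Finset.sum_mul]
  rw [Finset.sum_range_succ', Finset.sum_range_succ]
  simp only [sub_smul, Finset.sum_sub_distrib, smul_mul_assoc, ← pow_succ]
  simp
  abel

lemma sum_abs_choose (m : ℕ) :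
    ∑ k ∈ Finset.range (2 * m), |(((2 * m).choose (k + 1) : ℝ) - (2 * m).choose k)|
      ≤ 2 * (Nat.centralBinom m : ℝ) - 2 := by
  rw [two_mul, Finset.sum_range_add, ← two_mul]
  have h1 : ∑ k ∈ Finset.range m, |(((2 * m).choose (k + 1) : ℝ) - (2 * m).choose k)| =
      (Nat.centralBinom m : ℝ) - 1 := by
    have := Finset.sum_range_sub (fun k => ((2 * m).choose k : ℝ)) m
    rw [Nat.choose_zero_right, Nat.cast_one, ← Nat.centralBinom_eq_two_mul_choose] at this
    rw [← this]
    refine Finset.sum_congr rfl fun k hk => abs_of_nonneg ?_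
    rw [Finset.mem_range] at hk
    have := Nat.choose_le_succ_of_lt_half_left (r := k) (n := 2 * m) (by omega)
    rw [sub_nonneg]
    exact_mod_cast this
  have h2 : ∑ k ∈ Finset.range m, |(((2 * m).choose (m + k + 1) : ℝ) - (2 * m).choose (m + k))| =
      (Nat.centralBinom m : ℝ) - 1 := by
    have := Finset.sum_range_sub' (fun k => ((2 * m).choose (m + k) : ℝ)) m
    rw [← two_mul, Nat.choose_self, Nat.cast_one, add_zero, ← Nat.centralBinom_eq_two_mul_choose] at this
    rw [← this]
    refine Finset.sum_congr rfl fun k hk => ?_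
    rw [abs_sub_comm]
    refine abs_of_nonneg ?_
    rw [Finset.mem_range] at hk
    have h := Nat.choose_succ_right_eq (2 * m) (m + k)
    have : (2 * m).choose (m + k + 1) ≤ (2 * m).choose (m + k) := by
      have h3 : 2 * m - (m + k) ≤ m + k + 1 := by omega
      have h4 : (2 * m).choose (m + k + 1) * (m + k + 1) ≤ (2 * m).choose (m + k) * (m + k + 1) := by
        rw [h]; exact Nat.mul_le_mul_left _ h3
      exact Nat.le_of_mul_le_mul_right h4 (by omega)
    rw [sub_nonneg]
    exact_mod_cast this
  rw [h1, h2]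
  linarith

lemma norm_one_add_pow (t : R) (ht : ‖t‖ ≤ 1) (m : ℕ) :
    ‖(1 + t) ^ (2 * m) * (1 - t)‖ ≤ 2 * (Nat.centralBinom m : ℝ) := by
  rw [one_add_pow_mul_one_sub]
  have h1 : ‖∑ k ∈ Finset.range (2 * m), (((2 * m).choose (k + 1) : ℝ) - (2 * m).choose k) • t ^ (k + 1)‖
      ≤ 2 * (Nat.centralBinom m : ℝ) - 2 := by
    refine (norm_sum_le _ _).trans (le_trans (Finset.sum_le_sum fun k _ => ?_) (sum_abs_choose m))
    rw [norm_smul, Real.norm_eq_abs]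
    exact mul_le_of_le_one_right (abs_nonneg _) (pow_norm_le_one ht _)
  have h2 : ‖t ^ (2 * m + 1)‖ ≤ 1 := pow_norm_le_one ht _
  refine (norm_sub_le _ _).trans ?_
  have h3 := norm_add_le (1 : R) (∑ k ∈ Finset.range (2 * m), (((2 * m).choose (k + 1) : ℝ) - (2 * m).choose k) • t ^ (k + 1))
  rw [norm_one] at h3
  linarith

lemma centralBinom_bound (m : ℕ) :
    ((Nat.centralBinom m : ℝ) / 4 ^ m) ^ 2 * (2 * m + 1) ≤ 1 := by
  induction m with
  | zero => simp
  | succ m ih =>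
    have h : ((m : ℝ) + 1) * (Nat.centralBinom (m + 1) : ℝ) = 2 * (2 * m + 1) * Nat.centralBinom m := by
      exact_mod_cast Nat.succ_mul_centralBinom_succ m
    have hm : (0 : ℝ) < (m : ℝ) + 1 := by positivity
    have h' : (Nat.centralBinom (m + 1) : ℝ) / 4 ^ (m + 1) =
        ((Nat.centralBinom m : ℝ) / 4 ^ m) * ((2 * m + 1) / (2 * (m + 1))) := by
      have : (Nat.centralBinom (m + 1) : ℝ) = 2 * (2 * m + 1) * Nat.centralBinom m / (m + 1) := by
        rw [eq_div_iff hm.ne', mul_comm, h]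
      rw [this, pow_succ]
      field_simp
      ring
    rw [h', mul_pow, div_pow (2 * (m : ℝ) + 1)]
    set β := ((Nat.centralBinom m : ℝ) / 4 ^ m) ^ 2
    have hβ : 0 ≤ β := sq_nonneg _
    push_cast
    have : β * ((2 * m + 1) ^ 2 / (2 * ((m : ℝ) + 1)) ^ 2) * (2 * (m + 1) + 1)
      = (β * (2 * m + 1)) * (((2 * m + 1) * (2 * m + 3)) / (2 * ((m : ℝ) + 1)) ^ 2) := by ring
    rw [this]
    refine mul_le_one₀ ih (by positivity) ?_
    rw [div_le_one (by positivity)]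
    nlinarith

/-- the main smoothness estimate for a pair of involutions -/
lemma invol_smooth (a b : R) (ha : ‖a‖ ≤ 1) (hb : ‖b‖ ≤ 1) (haa : a * a = 1) (hbb : b * b = 1) (j : ℕ) :
    ‖((1 / 2 : ℝ) • (a + b)) ^ j * ((1 / 2 : ℝ) • (a - b))‖ ^ 2 * ((j : ℝ) + 1) ≤ 2 := by
  set u := (1 / 2 : ℝ) • (a + b) with hu
  set v := (1 / 2 : ℝ) • (a - b) with hv
  set t := a * b with ht
  set s := b * a with hs
  have hts : t * s = 1 := by
    rw [ht, hs, mul_assoc, ← mul_assoc b, hbb, one_mul, haa]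
  have hst : s * t = 1 := by
    rw [ht, hs, mul_assoc, ← mul_assoc a, haa, one_mul, hbb]
  have cst : Commute s t := hst.trans hts.symm
  have nt : ‖t‖ ≤ 1 := (norm_mul_le _ _).trans (mul_le_one₀ ha (norm_nonneg _) hb)
  have ns : ‖s‖ ≤ 1 := (norm_mul_le _ _).trans (mul_le_one₀ hb (norm_nonneg _) ha)
  have u2 : u ^ 2 = (1 / 4 : ℝ) • (s * (1 + t) ^ 2) := by
    have e1 : u ^ 2 = (1 / 4 : ℝ) • (1 + t + (s + 1)) := by
      rw [hu, pow_two, smul_mul_smul_comm, add_mul, mul_add, mul_add, haa, hbb, ht, hs]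
      module
    have e2 : s * (1 + t) ^ 2 = 1 + t + (s + 1) := by
      rw [pow_two, mul_add, mul_one, mul_add, ← mul_assoc, mul_add, hst, mul_one, add_mul, hst, one_mul]
      abel
    rw [e1, e2]
  have nu : ‖u‖ ≤ 1 := by
    rw [hu, norm_smul, Real.norm_of_nonneg (by norm_num)]
    have := norm_add_le a b
    linarith
  have v_eq : v = (1 / 2 : ℝ) • (a * (1 - t)) := by
    rw [hv, ht, mul_sub, mul_one, ← mul_assoc, haa, one_mul]
  have c1 : Commute (u ^ 2) a := by
    have : Commute (a * b + b * a) a := by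
      unfold Commute SemiconjBy
      rw [mul_add, add_mul, ← mul_assoc, haa, mul_assoc b, haa, one_mul, mul_one, mul_assoc]
      abel
    have e1 : u ^ 2 = (1 / 4 : ℝ) • (1 + 1 + (a * b + b * a)) := by
      rw [hu, pow_two, smul_mul_smul_comm, add_mul, mul_add, mul_add, haa, hbb]
      module
    rw [e1]
    exact ((((Commute.one_left a).add_left (Commute.one_left a))).add_left this).smul_left _
  have even : ∀ m : ℕ, ‖u ^ (2 * m) * v‖ ≤ (Nat.centralBinom m : ℝ) / 4 ^ m := by
    intro m
    have e : u ^ (2 * m) * v = (1 / 2 : ℝ) • ((1 / 4 : ℝ) ^ m • (a * (s ^ m * ((1 + t) ^ (2 * m) * (1 - t))))) := by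
      rw [v_eq, mul_smul_comm]
      congr 1
      rw [pow_mul, ← mul_assoc, (c1.pow_left m).eq, u2, smul_pow,
        (((Commute.one_right s).add_right cst).pow_right 2).mul_pow, ← pow_mul]
      simp only [mul_smul_comm, smul_mul_assoc, mul_assoc]
    rw [e, norm_smul, norm_smul, Real.norm_of_nonneg (by norm_num), Real.norm_of_nonneg (by positivity)]
    have h1 := norm_one_add_pow t nt m
    set y := (1 + t) ^ (2 * m) * (1 - t)
    have h2 : ‖a * (s ^ m * y)‖ ≤ ‖y‖ := by
      refine (norm_mul_le _ _).trans ((mul_le_of_le_one_left (norm_nonneg _) ha).trans ?_)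
      exact (norm_mul_le _ _).trans (mul_le_of_le_one_left (norm_nonneg _) (pow_norm_le_one ns _))
    calc _ ≤ 1 / 2 * ((1 / 4) ^ m * (2 * (Nat.centralBinom m : ℝ))) := by gcongr; exact h2.trans h1
      _ = _ := by rw [one_div_pow]; ring
  have even2 : ∀ m : ℕ, ‖u ^ (2 * m) * v‖ ^ 2 * (2 * m + 1) ≤ 1 := by
    intro m
    refine le_trans ?_ (centralBinom_bound m)
    gcongr
    exact even m
  obtain ⟨m, r, hj, hr⟩ : ∃ m r : ℕ, j = r + 2 * m ∧ r ≤ 1 := ⟨j / 2, j % 2, by omega, by omega⟩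
  have h1 : ‖u ^ j * v‖ ≤ ‖u ^ (2 * m) * v‖ := by
    rw [hj, pow_add, mul_assoc]
    exact (norm_mul_le _ _).trans (mul_le_of_le_one_left (norm_nonneg _) (pow_norm_le_one nu _))
  have h2 : (j : ℝ) + 1 ≤ 2 * (2 * m + 1) := by
    have : j + 1 ≤ 2 * (2 * m + 1) := by omega
    exact_mod_cast this
  calc _ ≤ ‖u ^ (2 * m) * v‖ ^ 2 * (2 * (2 * m + 1)) := by gcongr
    _ = 2 * (‖u ^ (2 * m) * v‖ ^ 2 * (2 * m + 1)) := by ring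
    _ ≤ 2 * 1 := by gcongr; exact even2 m
    _ = 2 := by norm_num

end Binomial

section L1Norm

variable {G : Type*} [Group G]

/-- the `ℓ¹` norm on the group algebra -/
noncomputable def nrm (x : MonoidAlgebra ℝ G) : ℝ := x.coeff.sum fun _ c => |c|

lemma nrm_eq (x : MonoidAlgebra ℝ G) (s : Finset G) (hs : x.coeff.support ⊆ s) :
    nrm x = ∑ g ∈ s, |x.coeff g| :=
  Finsupp.sum_of_support_subset _ hs _ (by simp)

lemma nrm_add (x y : MonoidAlgebra ℝ G) : nrm (x + y) ≤ nrm x + nrm y := by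
  classical
  rw [nrm_eq (x + y) (x.coeff.support ∪ y.coeff.support) (by rw [MonoidAlgebra.coeff_add]; exact Finsupp.support_add),
    nrm_eq x _ Finset.subset_union_left, nrm_eq y _ Finset.subset_union_right, ← Finset.sum_add_distrib]
  exact Finset.sum_le_sum fun g _ => abs_add_le _ _

lemma nrm_zero : nrm (0 : MonoidAlgebra ℝ G) = 0 := by simp [nrm]

lemma nrm_nonneg (x : MonoidAlgebra ℝ G) : 0 ≤ nrm x := Finset.sum_nonneg fun _ _ => abs_nonneg _

lemma nrm_single (g : G) (r : ℝ) : nrm (MonoidAlgebra.single g r) = |r| := by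
  simp [nrm, Finsupp.sum_single_index]

lemma nrm_smul (r : ℝ) (x : MonoidAlgebra ℝ G) : nrm (r • x) = |r| * nrm x := by
  rw [nrm_eq (r • x) x.coeff.support (by rw [MonoidAlgebra.coeff_smul]; exact Finsupp.support_smul),
    nrm_eq x x.coeff.support subset_rfl, Finset.mul_sum]
  simp [abs_mul]

lemma nrm_sum {ι : Type*} (s : Finset ι) (f : ι → MonoidAlgebra ℝ G) :
    nrm (∑ i ∈ s, f i) ≤ ∑ i ∈ s, nrm (f i) := by
  classical
  induction s using Finset.induction_on with
  | empty => simp [nrm_zero]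
  | insert i s hi ih =>
    rw [Finset.sum_insert hi, Finset.sum_insert hi]
    exact (nrm_add _ _).trans (by linarith)

lemma nrm_mul (x y : MonoidAlgebra ℝ G) : nrm (x * y) ≤ nrm x * nrm y := by
  rw [MonoidAlgebra.mul_def]
  simp only [Finsupp.sum]
  refine (nrm_sum _ _).trans ?_
  have : nrm x * nrm y = ∑ g ∈ x.coeff.support, |x.coeff g| * ∑ h ∈ y.coeff.support, |y.coeff h| := by
    rw [← Finset.sum_mul]; rfl
  rw [this]
  refine Finset.sum_le_sum fun g _ => ?_
  refine (nrm_sum _ _).trans ?_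
  rw [Finset.mul_sum]
  refine Finset.sum_le_sum fun h _ => ?_
  rw [nrm_single, abs_mul]

lemma nrm_eq_zero (x : MonoidAlgebra ℝ G) (hx : nrm x = 0) : x = 0 := by
  rw [nrm, Finsupp.sum, Finset.sum_eq_zero_iff_of_nonneg (fun _ _ => abs_nonneg _)] at hx
  rw [← MonoidAlgebra.coeff_eq_zero]
  ext g
  by_cases hg : g ∈ x.coeff.support
  · simpa using hx g hg
  · simpa using hg

lemma nrm_neg (x : MonoidAlgebra ℝ G) : nrm (-x) = nrm x := by
  have := nrm_smul (-1) x
  simpa using this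

/-- the `ℓ¹` norm as a ring norm -/
noncomputable def ringNrm (G : Type*) [Group G] : RingNorm (MonoidAlgebra ℝ G) where
  toFun := nrm
  map_zero' := nrm_zero
  add_le' := nrm_add
  neg' := nrm_neg
  mul_le' := nrm_mul
  eq_zero_of_map_eq_zero' := nrm_eq_zero

noncomputable instance instNormedRingMA : NormedRing (MonoidAlgebra ℝ G) := (ringNrm G).toNormedRing

lemma norm_def (x : MonoidAlgebra ℝ G) : ‖x‖ = nrm x := rfl

noncomputable instance instNormedAlgebraMA : NormedAlgebra ℝ (MonoidAlgebra ℝ G) where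
  norm_smul_le r x := by
    rw [norm_def, norm_def, nrm_smul, Real.norm_eq_abs]

instance instNormOneMA : NormOneClass (MonoidAlgebra ℝ G) where
  norm_one := by rw [norm_def, MonoidAlgebra.one_def, nrm_single]; simp

lemma norm_single (g : G) (r : ℝ) : ‖(MonoidAlgebra.single g r : MonoidAlgebra ℝ G)‖ = |r| := nrm_single g r

end L1Norm



section Invol

variable {R : Type*} [NormedRing R] [NormedAlgebra ℝ R] [NormOneClass R]
variable {ι : Type*} [DecidableEq ι]

lemma dihRel_of_invol (a b : ι × Bool → R) (na : ∀ p, ‖a p‖ ≤ 1) (nb : ∀ p, ‖b p‖ ≤ 1)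
    (aa : ∀ p, a p * a p = 1) (bb : ∀ p, b p * b p = 1)
    (caa : ∀ p q, p ≠ q → Commute (a p) (a q)) (cab : ∀ p q, p ≠ q → Commute (a p) (b q))
    (cbb : ∀ p q, p ≠ q → Commute (b p) (b q))
    (cen : ∀ p x, Commute (a p * b p + b p * a p) x) :
    DihRel (fun p => (1 / 2 : ℝ) • (a p + b p)) (fun p => (1 / 2 : ℝ) • (a p - b p)) 2 where
  uu p q := by
    by_cases h : p = q
    · subst h; exact Commute.refl _
    · refine Commute.smul_left (Commute.smul_right ?_ _) _
      exact ((caa p q h).add_right (cab p q h)).add_left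
        ((cab q p (Ne.symm h)).symm.add_right (cbb p q h))
  vv p q := by
    by_cases h : p = q
    · subst h; exact Commute.refl _
    · refine Commute.smul_left (Commute.smul_right ?_ _) _
      exact ((caa p q h).sub_right (cab p q h)).sub_left
        ((cab q p (Ne.symm h)).symm.sub_right (cbb p q h))
  uv p q h := by
    refine Commute.smul_left (Commute.smul_right ?_ _) _
    exact ((caa p q h).sub_right (cab p q h)).add_left
        ((cab q p (Ne.symm h)).symm.sub_right (cbb p q h))
  anti p := by
    simp only [smul_mul_smul_comm, add_mul, mul_add, sub_mul, mul_sub, aa, bb]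
    module
  sqs p := by
    simp only [smul_mul_smul_comm, add_mul, mul_add, sub_mul, mul_sub, aa, bb]
    module
  cen p x := by
    have e : ((1 / 2 : ℝ) • (a p + b p)) * ((1 / 2 : ℝ) • (a p + b p)) =
        (1 / 4 : ℝ) • (1 + 1 + (a p * b p + b p * a p)) := by
      simp only [smul_mul_smul_comm, add_mul, mul_add, aa, bb]
      module
    simp only [e]
    exact ((((Commute.one_left x).add_left (Commute.one_left x))).add_left (cen p x)).smul_left _
  normu p := by
    rw [norm_smul, Real.norm_of_nonneg (by norm_num)]
    have := norm_add_le (a p) (b p)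
    have := na p
    have := nb p
    linarith
  smooth p j := invol_smooth (a p) (b p) (na p) (nb p) (aa p) (bb p) j
  kk i := by
    have e : ((1 / 2 : ℝ) • (a (i, false) + b (i, false))) * ((1 / 2 : ℝ) • (a (i, true) + b (i, true))) +
        ((1 / 2 : ℝ) • (a (i, false) - b (i, false))) * ((1 / 2 : ℝ) • (a (i, true) - b (i, true))) =
        (1 / 2 : ℝ) • (a (i, false) * a (i, true) + b (i, false) * b (i, true)) := by
      simp only [smul_mul_smul_comm, add_mul, mul_add, sub_mul, mul_sub]
      module
    simp only [e]
    rw [norm_smul, Real.norm_of_nonneg (by norm_num)]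
    have h0 := norm_add_le (a (i, false) * a (i, true)) (b (i, false) * b (i, true))
    have h1 : ‖a (i, false) * a (i, true)‖ ≤ 1 := (norm_mul_le _ _).trans (mul_le_one₀ (na _) (norm_nonneg _) (na _))
    have h2 : ‖b (i, false) * b (i, true)‖ ≤ 1 := (norm_mul_le _ _).trans (mul_le_one₀ (nb _) (norm_nonneg _) (nb _))
    linarith

end Invol

section DInfGroup

lemma Da_sq : Da * Da = 1 := by
  have h : FreeGroup.of (0 : Fin 2) ^ 2 ∈ dihedralRels := Or.inl rfl
  have := PresentedGroup.one_of_mem h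
  rw [pow_two, map_mul] at this
  exact this

lemma Db_sq : Db * Db = 1 := by
  have h : FreeGroup.of (1 : Fin 2) ^ 2 ∈ dihedralRels := Or.inr rfl
  have := PresentedGroup.one_of_mem h
  rw [pow_two, map_mul] at this
  exact this

lemma dinf_induction {P : DInf → Prop} (one : P 1) (ha : ∀ x, P x → P (Da * x))
    (hb : ∀ x, P x → P (Db * x)) (x : DInf) : P x := by
  have hx : x ∈ Subgroup.closure (Set.range (PresentedGroup.of : Fin 2 → DInf)) := by
    rw [PresentedGroup.closure_range_of]; trivial
  have hg : ∀ i : Fin 2, ∀ y, P y → P ((PresentedGroup.of i : DInf) * y) := by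
    intro i y hy
    fin_cases i
    · exact ha y hy
    · exact hb y hy
  have hi : ∀ i : Fin 2, ((PresentedGroup.of i : DInf))⁻¹ = PresentedGroup.of i := by
    intro i
    fin_cases i
    · exact inv_eq_of_mul_eq_one_left Da_sq
    · exact inv_eq_of_mul_eq_one_left Db_sq
  induction hx using Subgroup.closure_induction_left with
  | one => exact one
  | mul_left x hx y hy ih => obtain ⟨i, rfl⟩ := hx; exact hg i y ih
  | inv_mul_cancel x hx y hy ih => obtain ⟨i, rfl⟩ := hx; rw [hi]; exact hg i y ih

lemma dinf_conj (x : DInf) : (Da * Db * x = x * (Da * Db) ∧ Db * Da * x = x * (Db * Da)) ∨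
    (Da * Db * x = x * (Db * Da) ∧ Db * Da * x = x * (Da * Db)) := by
  induction x using dinf_induction with
  | one => left; simp
  | ha x ih =>
    have e1 : Da * Db * (Da * x) = Da * (Db * Da * x) := by simp only [mul_assoc]
    have e2 : Db * Da * (Da * x) = Da * (Da * Db * x) := by
      rw [mul_assoc, ← mul_assoc Da Da x, Da_sq, one_mul, ← mul_assoc Da, ← mul_assoc Da, Da_sq, one_mul]
    rw [e1, e2]
    rcases ih with ⟨h1, h2⟩ | ⟨h1, h2⟩
    · right; rw [h1, h2]; simp only [mul_assoc, and_self]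
    · left; rw [h1, h2]; simp only [mul_assoc, and_self]
  | hb x ih =>
    have e1 : Db * Da * (Db * x) = Db * (Da * Db * x) := by simp only [mul_assoc]
    have e2 : Da * Db * (Db * x) = Db * (Db * Da * x) := by
      rw [mul_assoc, ← mul_assoc Db Db x, Db_sq, one_mul, ← mul_assoc Db, ← mul_assoc Db, Db_sq, one_mul]
    rw [e1, e2]
    rcases ih with ⟨h1, h2⟩ | ⟨h1, h2⟩
    · right; rw [h1, h2]; simp only [mul_assoc, and_self]
    · left; rw [h1, h2]; simp only [mul_assoc, and_self]

variable {d : ℕ}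

/-- embedding of a coordinate -/
noncomputable def emb (p : Fin d × Bool) : DInf →* (Fin d → DInf) × (Fin d → DInf) :=
  (if p.2 then MonoidHom.inr (Fin d → DInf) (Fin d → DInf) else MonoidHom.inl (Fin d → DInf) (Fin d → DInf)).comp
    (MonoidHom.mulSingle (fun _ : Fin d => DInf) p.1)

/-- coordinate -/
def prj (p : Fin d × Bool) (g : (Fin d → DInf) × (Fin d → DInf)) : DInf :=
  if p.2 then g.2 p.1 else g.1 p.1

lemma emb_false (i : Fin d) (x : DInf) : emb (i, false) x = (Pi.mulSingle i x, 1) := rfl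
lemma emb_true (i : Fin d) (x : DInf) : emb (i, true) x = (1, Pi.mulSingle i x) := rfl

lemma single_mul_comm_aux (i : Fin d) (x y : DInf) (g : Fin d → DInf) (h : x * g i = g i * y) :
    Pi.mulSingle i x * g = g * Pi.mulSingle i y := by
  funext j
  by_cases hj : j = i
  · subst hj; simpa using h
  · simp [hj]

lemma emb_conj (p : Fin d × Bool) (x y : DInf) (g : (Fin d → DInf) × (Fin d → DInf))
    (h : x * prj p g = prj p g * y) : emb p x * g = g * emb p y := by
  obtain ⟨i, b⟩ := p
  obtain ⟨g1, g2⟩ := g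
  cases b
  · rw [emb_false, emb_false, Prod.mk_mul_mk, Prod.mk_mul_mk, one_mul, mul_one,
      single_mul_comm_aux i x y g1 h]
  · rw [emb_true, emb_true, Prod.mk_mul_mk, Prod.mk_mul_mk, one_mul, mul_one,
      single_mul_comm_aux i x y g2 h]

lemma emb_comm (p q : Fin d × Bool) (hpq : p ≠ q) (x y : DInf) : Commute (emb p x) (emb q y) := by
  refine emb_conj p x x _ ?_
  have : prj p (emb q y) = 1 := by
    obtain ⟨i, b⟩ := p
    obtain ⟨j, c⟩ := q
    cases b <;> cases c
    · rw [emb_false]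
      have : i ≠ j := by rintro rfl; exact hpq rfl
      simp [prj, this]
    · simp [emb_true, prj]
    · simp [emb_false, prj]
    · rw [emb_true]
      have : i ≠ j := by rintro rfl; exact hpq rfl
      simp [prj, this]
  simp [this]

/-- group algebra elements -/
noncomputable def sg (p : Fin d × Bool) (x : DInf) : MonoidAlgebra ℝ ((Fin d → DInf) × (Fin d → DInf)) :=
  MonoidAlgebra.single (emb p x) 1

lemma sg_mul (p : Fin d × Bool) (x y : DInf) : sg p x * sg p y = sg p (x * y) := by
  simp [sg, MonoidAlgebra.single_mul_single]

lemma sg_one (p : Fin d × Bool) : sg p (1 : DInf) = 1 := by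
  simp [sg, MonoidAlgebra.one_def]

lemma sg_comm (p q : Fin d × Bool) (hpq : p ≠ q) (x y : DInf) : Commute (sg p x) (sg q y) :=
  MonoidAlgebra.single_commute_single (emb_comm p q hpq x y) (Commute.refl _)

lemma sg_cen (p : Fin d × Bool) (X : MonoidAlgebra ℝ ((Fin d → DInf) × (Fin d → DInf))) :
    Commute (sg p Da * sg p Db + sg p Db * sg p Da) X := by
  rw [sg_mul, sg_mul]
  induction X using MonoidAlgebra.induction_linear with
  | zero => exact Commute.zero_right _
  | add f g hf hg => exact hf.add_right hg
  | single g r =>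
    unfold Commute SemiconjBy sg
    simp only [add_mul, mul_add, MonoidAlgebra.single_mul_single, one_mul, mul_one]
    rcases dinf_conj (prj p g) with ⟨h1, h2⟩ | ⟨h1, h2⟩
    · rw [emb_conj p _ _ g h1, emb_conj p _ _ g h2]
    · rw [emb_conj p _ _ g h1, emb_conj p _ _ g h2, add_comm]

lemma dihRel_DInf : DihRel (fun p : Fin d × Bool => (1 / 2 : ℝ) • (sg p Da + sg p Db))
    (fun p => (1 / 2 : ℝ) • (sg p Da - sg p Db)) 2 := by
  refine dihRel_of_invol _ _ (fun p => ?_) (fun p => ?_) (fun p => ?_) (fun p => ?_)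
    (fun p q h => sg_comm p q h _ _) (fun p q h => sg_comm p q h _ _) (fun p q h => sg_comm p q h _ _) sg_cen
  · simp [sg, norm_single]
  · simp [sg, norm_single]
  · rw [sg_mul, Da_sq, sg_one]
  · rw [sg_mul, Db_sq, sg_one]

end DInfGroup



section Bridge

variable {H : Type*} [Group H]

lemma conv_coeff (x y : MonoidAlgebra ℝ H) : conv (⇑x.coeff) (⇑y.coeff) = ⇑(x * y).coeff := by
  funext g
  rw [MonoidAlgebra.coeff_mul_apply_left, conv, Finsupp.sum]
  refine tsum_eq_sum fun b hb => ?_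
  rw [Finsupp.notMem_support_iff.1 hb, zero_mul]

lemma convPow_coeff (x : MonoidAlgebra ℝ H) (n : ℕ) : convPow (⇑x.coeff) n = ⇑(x ^ n).coeff := by
  classical
  induction n with
  | zero =>
    funext g
    rw [pow_zero, MonoidAlgebra.one_def, MonoidAlgebra.coeff_single, Finsupp.single_apply, convPow,
      Set.indicator_apply]
    simp [eq_comm]
  | succ n ih =>
    rw [convPow, ih, conv_coeff, pow_succ']

lemma l1dist_coeff (x y : MonoidAlgebra ℝ H) : l1dist (⇑x.coeff) (⇑y.coeff) = ‖x - y‖ := by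
  rw [norm_def, nrm, l1dist, Finsupp.sum]
  rw [tsum_eq_sum (s := (x - y).coeff.support)]
  · simp
  · intro b hb
    have := Finsupp.notMem_support_iff.1 hb
    rw [MonoidAlgebra.coeff_sub] at this
    simpa using this

lemma coeff_inl_inr (x y : MonoidAlgebra ℝ H) (g h : H) :
    (MonoidAlgebra.mapDomainRingHom ℝ (MonoidHom.inl H H) x *
      MonoidAlgebra.mapDomainRingHom ℝ (MonoidHom.inr H H) y).coeff (g, h) = x.coeff g * y.coeff h := by
  classical
  induction x using MonoidAlgebra.induction_linear with
  | zero => simp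
  | add f f' hf hf' => rw [map_add, add_mul, MonoidAlgebra.coeff_add, MonoidAlgebra.coeff_add,
      Finsupp.add_apply, Finsupp.add_apply, hf, hf', add_mul]
  | single a r =>
    induction y using MonoidAlgebra.induction_linear with
    | zero => simp
    | add f f' hf hf' => rw [map_add, mul_add, MonoidAlgebra.coeff_add, MonoidAlgebra.coeff_add,
        Finsupp.add_apply, Finsupp.add_apply, hf, hf', mul_add]
    | single b s =>
      simp only [MonoidAlgebra.mapDomainRingHom_apply, MonoidAlgebra.mapDomain_single,
        MonoidAlgebra.single_mul_single, MonoidAlgebra.coeff_single, Finsupp.single_apply,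
        MonoidHom.inl_apply, MonoidHom.inr_apply, Prod.mk_mul_mk, one_mul, mul_one, Prod.mk.injEq]
      by_cases h1 : a = g <;> by_cases h2 : b = h <;> simp [h1, h2]

lemma comm_inl_inr (x y : MonoidAlgebra ℝ H) :
    Commute (MonoidAlgebra.mapDomainRingHom ℝ (MonoidHom.inl H H) x)
      (MonoidAlgebra.mapDomainRingHom ℝ (MonoidHom.inr H H) y) := by
  induction x using MonoidAlgebra.induction_linear with
  | zero => simp
  | add f f' hf hf' => rw [map_add]; exact hf.add_left hf'
  | single a r =>
    induction y using MonoidAlgebra.induction_linear with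
    | zero => simp
    | add f f' hf hf' => rw [map_add]; exact hf.add_right hf'
    | single b s =>
      simp only [MonoidAlgebra.mapDomainRingHom_apply, MonoidAlgebra.mapDomain_single]
      exact MonoidAlgebra.single_commute_single (by simp [Commute, SemiconjBy]) (Commute.all _ _)

/-- the diagonal homomorphism -/
def dg (H : Type*) [Group H] : H →* H × H := (MonoidHom.id H).prod (MonoidHom.id H)

lemma coeff_dg (x : MonoidAlgebra ℝ H) :
    ⇑(MonoidAlgebra.mapDomainRingHom ℝ (dg H) x).coeff = diagM (⇑x.coeff) := by
  classical
  funext p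
  obtain ⟨g, h⟩ := p
  rw [diagM, Set.indicator_apply]
  simp only [Set.mem_ofPred_eq]
  induction x using MonoidAlgebra.induction_linear with
  | zero => simp
  | add f f' hf hf' =>
    rw [map_add, MonoidAlgebra.coeff_add, Finsupp.add_apply, hf, hf', MonoidAlgebra.coeff_add,
      Finsupp.add_apply]
    split_ifs <;> simp
  | single a r =>
    simp only [MonoidAlgebra.mapDomainRingHom_apply, MonoidAlgebra.mapDomain_single,
        MonoidAlgebra.coeff_single, Finsupp.single_apply]
    have : dg H a = (a, a) := rfl
    simp only [this, Prod.mk.injEq]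
    by_cases h1 : a = g
    · subst h1; simp
    · by_cases h2 : g = h <;> simp [h1]

end Bridge

section Meas

variable {d : ℕ}

/-- the lazy step in the coordinate `i` -/
noncomputable def stp (i : Fin d) : MonoidAlgebra ℝ (Fin d → DInf) :=
  (1 / 3 : ℝ) • (MonoidAlgebra.single (Pi.mulSingle i 1) 1 + MonoidAlgebra.single (Pi.mulSingle i Da) 1 +
    MonoidAlgebra.single (Pi.mulSingle i Db) 1)

open Classical in
lemma coeff_stp_prod (l : List (Fin d)) (hl : l.Nodup) (g : Fin d → DInf) :
    (l.map stp).prod.coeff g = (l.map fun i => muLazy (g i)).prod * (if ∀ j, j ∉ l → g j = 1 then 1 else 0) := by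
  induction l generalizing g with
  | nil =>
    rw [List.map_nil, List.prod_nil, MonoidAlgebra.one_def, MonoidAlgebra.coeff_single, Finsupp.single_apply]
    simp [funext_iff, eq_comm]
  | cons i l ih =>
    obtain ⟨hi, hl⟩ := List.nodup_cons.1 hl
    have key : ∀ c : DInf, (MonoidAlgebra.single (Pi.mulSingle i c) (1 : ℝ) * (l.map stp).prod).coeff g =
        (if g i = c then 1 else 0) * ((l.map fun i => muLazy (g i)).prod *
          (if ∀ j, j ∉ i :: l → g j = 1 then 1 else 0)) := by
      intro c
      rw [MonoidAlgebra.coeff_single_mul_apply, one_mul, ih hl]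
      have e0 : ∀ j, j ≠ i → ((Pi.mulSingle i c : Fin d → DInf)⁻¹ * g) j = g j := by
        intro j hj; simp [hj]
      have e1 : ((Pi.mulSingle i c : Fin d → DInf)⁻¹ * g) i = c⁻¹ * g i := by simp
      have e2 : (l.map fun j => muLazy (((Pi.mulSingle i c : Fin d → DInf)⁻¹ * g) j)) = l.map fun i => muLazy (g i) := by
        refine List.map_congr_left fun j hj => ?_
        rw [e0 j (by rintro rfl; exact hi hj)]
      rw [e2]
      have e3 : (∀ j, j ∉ l → ((Pi.mulSingle i c : Fin d → DInf)⁻¹ * g) j = 1) ↔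
          (g i = c ∧ ∀ j, j ∉ i :: l → g j = 1) := by
        constructor
        · intro h
          refine ⟨?_, fun j hj => ?_⟩
          · have := h i hi
            rw [e1, inv_mul_eq_one] at this
            exact this.symm
          · rw [List.mem_cons, not_or] at hj
            rw [← e0 j hj.1]; exact h j hj.2
        · rintro ⟨h1, h2⟩ j hj
          by_cases hji : j = i
          · subst hji; rw [e1, h1, inv_mul_cancel]
          · rw [e0 j hji]; exact h2 j (by simp [hji, hj])
      simp only [e3]
      by_cases h1 : g i = c <;> simp [h1]
    rw [List.map_cons, List.prod_cons, stp, smul_mul_assoc, add_mul, add_mul, MonoidAlgebra.coeff_smul,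
      Finsupp.smul_apply, MonoidAlgebra.coeff_add, MonoidAlgebra.coeff_add, Finsupp.add_apply, Finsupp.add_apply,
      key, key, key, List.map_cons, List.prod_cons]
    simp only [muLazy, Set.indicator_apply, Set.mem_singleton_iff, smul_eq_mul]
    split_ifs <;> ring

lemma coeff_mu : ⇑((List.finRange d).map stp).prod.coeff = muLazyPow d := by
  classical
  funext g
  rw [coeff_stp_prod _ (List.nodup_finRange d)]
  simp only [List.mem_finRange, not_true_eq_false, false_imp_iff, implies_true, if_true, mul_one]
  rw [muLazyPow, ← List.ofFn_eq_map, List.prod_ofFn]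


lemma mapDomain_smul' {H K : Type*} [Group H] [Group K] (f : H →* K) (r : ℝ) (x : MonoidAlgebra ℝ H) :
    MonoidAlgebra.mapDomainRingHom ℝ f (r • x) = r • MonoidAlgebra.mapDomainRingHom ℝ f x :=
  map_smul (MonoidAlgebra.mapDomainAlgHom ℝ ℝ f) r x

variable (d) in
lemma dg_mu : MonoidAlgebra.mapDomainRingHom ℝ (dg (Fin d → DInf)) ((List.finRange d).map stp).prod =
    ((List.finRange d).map (kf (fun p : Fin d × Bool => (1 / 2 : ℝ) • (sg p Da + sg p Db))
    (fun p => (1 / 2 : ℝ) • (sg p Da - sg p Db)))).prod := by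
  rw [map_list_prod, List.map_map]
  congr 1
  refine List.map_congr_left fun i _ => ?_
  have e : ∀ c : DInf, MonoidAlgebra.mapDomainRingHom ℝ (dg (Fin d → DInf)) (MonoidAlgebra.single (Pi.mulSingle i c) 1)
      = sg (i, false) c * sg (i, true) c := by
    intro c
    simp [sg, emb_false, emb_true, MonoidAlgebra.single_mul_single, dg]
  simp only [Function.comp_apply, stp, mapDomain_smul', map_add, e, sg_one, kf, lz,
    smul_mul_smul_comm, add_mul, mul_add, sub_mul, mul_sub, mul_one]
  module

lemma list_prod_mul {R ι : Type*} [Monoid R] (f g : ι → R) (h : ∀ i j, Commute (f i) (g j)) (l : List ι) :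
    (l.map f).prod * (l.map g).prod = (l.map fun i => f i * g i).prod := by
  induction l with
  | nil => simp
  | cons i l ih =>
    have hc : ∀ l : List ι, Commute (l.map f).prod (g i) := by
      intro l
      induction l with
      | nil => simp
      | cons j l ih => rw [List.map_cons, List.prod_cons]; exact (h j i).mul_left ih
    simp only [List.map_cons, List.prod_cons]
    rw [← ih, mul_assoc, ← mul_assoc _ (g i), (hc l).eq]
    simp only [mul_assoc]

variable (d) in
lemma lr_mu : MonoidAlgebra.mapDomainRingHom ℝ (MonoidHom.inl _ _) ((List.finRange d).map stp).prod *
    MonoidAlgebra.mapDomainRingHom ℝ (MonoidHom.inr _ _) ((List.finRange d).map stp).prod =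
    ((List.finRange d).map (qf (fun p : Fin d × Bool => (1 / 2 : ℝ) • (sg p Da + sg p Db)))).prod := by
  rw [map_list_prod, map_list_prod, List.map_map, List.map_map, list_prod_mul]
  · congr 1
    refine List.map_congr_left fun i _ => ?_
    have e1 : ∀ c : DInf, MonoidAlgebra.mapDomainRingHom ℝ (MonoidHom.inl (Fin d → DInf) (Fin d → DInf))
        (MonoidAlgebra.single (Pi.mulSingle i c) 1) = sg (i, false) c := by
      intro c
      simp [sg, emb_false]
    have e2 : ∀ c : DInf, MonoidAlgebra.mapDomainRingHom ℝ (MonoidHom.inr (Fin d → DInf) (Fin d → DInf))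
        (MonoidAlgebra.single (Pi.mulSingle i c) 1) = sg (i, true) c := by
      intro c
      simp [sg, emb_true]
    simp only [Function.comp_apply, stp, mapDomain_smul', map_add, e1, e2, sg_one, qf, lz]
    congr 1 <;> module
  · intro i j
    exact comm_inl_inr _ _

lemma l1NS : L1NoiseSensitive (muLazyPow d) := by
  intro ρ hρ
  have key := (dihRel_DInf (d := d)).main (List.finRange d) (List.nodup_finRange d) ρ hρ.1 hρ.2.le
  rw [← dg_mu, ← lr_mu] at key
  refine key.congr fun n => ?_
  rw [← l1dist_coeff, ← convPow_coeff, (comm_inl_inr _ _).mul_pow, ← map_pow, ← map_pow]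
  congr 2
  · funext p
    rw [noise, ← coeff_mu, ← coeff_dg]
    obtain ⟨g, h⟩ := p
    rw [MonoidAlgebra.coeff_add, Finsupp.add_apply, MonoidAlgebra.coeff_smul, MonoidAlgebra.coeff_smul,
      Finsupp.smul_apply, Finsupp.smul_apply, coeff_inl_inr]
    rfl
  · funext p
    obtain ⟨g, h⟩ := p
    rw [coeff_inl_inr, ← coeff_mu, prodM, convPow_coeff]

end Meas



section FiniteIndex

/-- the translation `ab` -/
def Dt : DInf := Da * Db

/-- comparison with the Mathlib dihedral group -/
def toDih : DInf →* DihedralGroup 0 :=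
  PresentedGroup.toGroup (f := fun i : Fin 2 => if i = 0 then DihedralGroup.sr 0 else DihedralGroup.sr 1) (by
    intro r hr
    rcases hr with rfl | rfl
    · simp [pow_two]
    · simp [pow_two])

/-- the sign -/
def sgn : DInf →* Multiplicative (ZMod 2) :=
  PresentedGroup.toGroup (f := fun _ : Fin 2 => Multiplicative.ofAdd (1 : ZMod 2)) (by
    intro r hr
    rcases hr with rfl | rfl
    · simp only [map_pow, FreeGroup.lift_apply_of]; decide
    · simp only [map_pow, FreeGroup.lift_apply_of]; decide)

lemma sgn_a : sgn Da = Multiplicative.ofAdd (1 : ZMod 2) := PresentedGroup.toGroup.of _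

lemma sgn_b : sgn Db = Multiplicative.ofAdd (1 : ZMod 2) := PresentedGroup.toGroup.of _

lemma sgn_t : sgn Dt = 1 := by
  rw [Dt, map_mul, sgn_a, sgn_b]; decide

lemma toDih_t : toDih Dt = DihedralGroup.r 1 := by
  have h1 : toDih Da = DihedralGroup.sr 0 := PresentedGroup.toGroup.of _
  have h2 : toDih Db = DihedralGroup.sr 1 := PresentedGroup.toGroup.of _
  rw [Dt, map_mul, h1, h2, DihedralGroup.sr_mul_sr, sub_zero]

lemma Dt_zpow_inj {m n : ℤ} (h : Dt ^ m = Dt ^ n) : m = n := by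
  have := congrArg toDih h
  rw [map_zpow, map_zpow, toDih_t, DihedralGroup.r_zpow, DihedralGroup.r_zpow, DihedralGroup.r.injEq,
    one_mul, one_mul] at this
  exact this

lemma Da_inv : Da⁻¹ = Da := inv_eq_of_mul_eq_one_right Da_sq

lemma Db_inv : Db⁻¹ = Db := inv_eq_of_mul_eq_one_right Db_sq

lemma Da_zpow (k : ℤ) : Da * Dt ^ k = Dt ^ (-k) * Da := by
  have h : Da * Dt * Da⁻¹ = Dt⁻¹ := by
    rw [Dt, mul_inv_rev, Da_inv, Db_inv, ← mul_assoc, Da_sq, one_mul]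
  have := conj_zpow (i := k) (a := Da) (b := Dt)
  rw [h, inv_zpow'] at this
  rw [this]; group

lemma dinf_form (g : DInf) : ∃ k : ℤ, g = Dt ^ k ∨ g = Dt ^ k * Da := by
  have hb : Db = Dt⁻¹ * Da := by rw [Dt, mul_inv_rev, Da_inv, Db_inv, mul_assoc, Da_sq, mul_one]
  have ha : ∀ x : DInf, (∃ k : ℤ, x = Dt ^ k ∨ x = Dt ^ k * Da) →
      ∃ k : ℤ, Da * x = Dt ^ k ∨ Da * x = Dt ^ k * Da := by
    rintro x ⟨k, rfl | rfl⟩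
    · exact ⟨-k, Or.inr (Da_zpow k)⟩
    · exact ⟨-k, Or.inl (by rw [← mul_assoc, Da_zpow, mul_assoc, Da_sq, mul_one])⟩
  induction g using dinf_induction with
  | one => exact ⟨0, Or.inl (by simp)⟩
  | ha x h => exact ha x h
  | hb x h =>
    obtain ⟨k, hk⟩ := ha x h
    refine ⟨-1 + k, ?_⟩
    rw [hb, mul_assoc, zpow_add, zpow_neg_one, mul_assoc]
    rcases hk with hk | hk
    · left; rw [hk]
    · right; rw [hk]

lemma sgn_ker {g : DInf} (h : sgn g = 1) : ∃ k : ℤ, Dt ^ k = g := by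
  obtain ⟨k, rfl | rfl⟩ := dinf_form g
  · exact ⟨k, rfl⟩
  · rw [map_mul, map_zpow, sgn_t, one_zpow, one_mul, sgn_a] at h
    exact absurd h (by decide)

/-- the embedding of `ℤ^d` -/
def embZ (d : ℕ) : Multiplicative (Fin d → ℤ) →* (Fin d → DInf) where
  toFun k := fun i => Dt ^ (Multiplicative.toAdd k i)
  map_one' := by funext i; simp
  map_mul' k l := by funext i; simp [zpow_add]

lemma embZ_inj (d : ℕ) : Function.Injective (embZ d) := by
  intro k l h
  apply Multiplicative.toAdd.injective
  funext i
  exact Dt_zpow_inj (congrFun h i)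

/-- coordinatewise sign -/
def sgnPi (d : ℕ) : (Fin d → DInf) →* (Fin d → Multiplicative (ZMod 2)) where
  toFun g := fun i => sgn (g i)
  map_one' := by funext i; simp
  map_mul' k l := by funext i; simp

lemma ker_le (d : ℕ) : (sgnPi d).ker ≤ (embZ d).range := by
  intro g hg
  have h : ∀ i, ∃ k : ℤ, Dt ^ k = g i := fun i => sgn_ker (congrFun hg i)
  choose k hk using h
  exact ⟨Multiplicative.ofAdd k, funext hk⟩

lemma fin_index (d : ℕ) : ∃ H : Subgroup (Fin d → DInf), H.index ≠ 0 ∧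
    Nonempty (H ≃* Multiplicative (Fin d → ℤ)) := by
  refine ⟨(embZ d).range, ?_, ⟨(MonoidHom.ofInjective (embZ_inj d)).symm⟩⟩
  have : Finite (Multiplicative (ZMod 2)) := inferInstanceAs (Finite (ZMod 2))
  have h1 : (sgnPi d).ker.FiniteIndex := Subgroup.finiteIndex_ker _
  exact (Subgroup.finiteIndex_of_le (ker_le d)).index_ne_zero

end FiniteIndex


/-- For every `d ≥ 1`, the `d`-fold power of the lazy walk on
`D∞` is `ℓ¹`-noise sensitive, and `(D∞)^d` has a finite index subgroup
isomorphic to `ℤ^d`. -/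
theorem dihedral_power_l1NS (d : ℕ) (hd : 0 < d) :
    L1NoiseSensitive (muLazyPow d) ∧
      ∃ H : Subgroup (Fin d → DInf), H.index ≠ 0 ∧
        Nonempty (H ≃* Multiplicative (Fin d → ℤ)) := by
  exact ⟨l1NS, fin_index d⟩

end NS
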